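/- arXiv:0910.4312 — 2 statements merged into one kernel-verified Lean document; each statement's English description precedes it below -/
import Mathlib

section
/- Let k be a positive integer with k ≡ 1 (mod 4). Then the restriction map π_{1+i} : J_{k,2}(O_K) → J_{k,4}, (π_{1+i}φ)(τ,z) = φ(τ,(1+i)z,(1-i)z), is an isomorphism of ℂ-vector spaces. -/
noncomputable section

open Complex

/-- `τ` lies in the upper half plane. -/
def UHP (τ : ℂ) : Prop := 0 < τ.im

/-- `eC w = exp(2 π i w)`. -/
def eC (w : ℂ) : ℂ := Complex.exp (2 * (Real.pi : ℂ) * Complex.I * w)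

/-- Entries of a matrix in `SL(2, ℤ)`, as complex numbers. -/
def Ma (M : Matrix.SpecialLinearGroup (Fin 2) ℤ) : ℂ := ((M.1 0 0 : ℤ) : ℂ)
def Mb (M : Matrix.SpecialLinearGroup (Fin 2) ℤ) : ℂ := ((M.1 0 1 : ℤ) : ℂ)
def Mc (M : Matrix.SpecialLinearGroup (Fin 2) ℤ) : ℂ := ((M.1 1 0 : ℤ) : ℂ)
def Md (M : Matrix.SpecialLinearGroup (Fin 2) ℤ) : ℂ := ((M.1 1 1 : ℤ) : ℂ)

/-- Hermitian Jacobi form of weight `k` and index `m` for the Hermitian Jacobi group over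
`ℤ[i]`.  A form is a function `φ : ℂ → ℂ → ℂ → ℂ`, all conditions being imposed for `τ`
in the upper half plane.  Units `ε ∈ ℤ[i]ˣ = {1, -1, i, -i}`, and the elliptic variables
`λ = p + q i`, `μ = u + v i` range over `ℤ[i]`.  The Fourier expansion is indexed by
`n ∈ ℕ` and `r = (a + b i)/2 ∈ O_K^♯ = (i/2)ℤ[i]`, supported on `N(r) ≤ n m`,
i.e. `a² + b² ≤ 4 n m`. -/
structure IsHJF (k m : ℕ) (φ : ℂ → ℂ → ℂ → ℂ) : Prop where
  holo : DifferentiableOn ℂ (fun p : ℂ × ℂ × ℂ => φ p.1 p.2.1 p.2.2) {p | UHP p.1}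
  transf : ∀ ε : ℂ, ε ∈ ({1, -1, Complex.I, -Complex.I} : Set ℂ) →
    ∀ M : Matrix.SpecialLinearGroup (Fin 2) ℤ, ∀ τ z₁ z₂ : ℂ, UHP τ →
      φ ((Ma M * τ + Mb M) / (Mc M * τ + Md M))
        (ε * z₁ / (Mc M * τ + Md M))
        ((starRingEnd ℂ) ε * z₂ / (Mc M * τ + Md M))
      = ε ^ k * (Mc M * τ + Md M) ^ k *
          eC ((m : ℂ) * Mc M * z₁ * z₂ / (Mc M * τ + Md M)) * φ τ z₁ z₂
  ellip : ∀ p q u v : ℤ, ∀ τ z₁ z₂ : ℂ, UHP τ →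
      φ τ (z₁ + ((p : ℂ) + (q : ℂ) * Complex.I) * τ + ((u : ℂ) + (v : ℂ) * Complex.I))
          (z₂ + ((p : ℂ) - (q : ℂ) * Complex.I) * τ + ((u : ℂ) - (v : ℂ) * Complex.I))
      = eC (-(m : ℂ) * (((p : ℂ) ^ 2 + (q : ℂ) ^ 2) * τ
          + ((p : ℂ) - (q : ℂ) * Complex.I) * z₁
          + ((p : ℂ) + (q : ℂ) * Complex.I) * z₂)) * φ τ z₁ z₂
  fourier : ∃ c : ℕ → ℤ → ℤ → ℂ,
      (∀ (n : ℕ) (a b : ℤ), 4 * (n : ℤ) * m < a ^ 2 + b ^ 2 → c n a b = 0) ∧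
      ∀ τ z₁ z₂ : ℂ, UHP τ →
        HasSum (fun p : ℕ × ℤ × ℤ => c p.1 p.2.1 p.2.2 *
          eC ((p.1 : ℂ) * τ + (((p.2.1 : ℂ) + (p.2.2 : ℂ) * Complex.I) / 2) * z₁
            + (((p.2.1 : ℂ) - (p.2.2 : ℂ) * Complex.I) / 2) * z₂)) (φ τ z₁ z₂)

/-- Classical Jacobi form of weight `k` and index `m` for `SL(2,ℤ) ⋉ ℤ²`. -/
structure IsJF (k m : ℕ) (φ : ℂ → ℂ → ℂ) : Prop where
  holo : DifferentiableOn ℂ (fun p : ℂ × ℂ => φ p.1 p.2) {p | UHP p.1}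
  transf : ∀ M : Matrix.SpecialLinearGroup (Fin 2) ℤ, ∀ τ z : ℂ, UHP τ →
      φ ((Ma M * τ + Mb M) / (Mc M * τ + Md M)) (z / (Mc M * τ + Md M))
      = (Mc M * τ + Md M) ^ k *
          eC ((m : ℂ) * Mc M * z ^ 2 / (Mc M * τ + Md M)) * φ τ z
  ellip : ∀ p q : ℤ, ∀ τ z : ℂ, UHP τ →
      φ τ (z + (p : ℂ) * τ + (q : ℂ))
      = eC (-(m : ℂ) * ((p : ℂ) ^ 2 * τ + 2 * (p : ℂ) * z)) * φ τ z
  fourier : ∃ c : ℕ → ℤ → ℂ,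
      (∀ (n : ℕ) (r : ℤ), 4 * (n : ℤ) * m < r ^ 2 → c n r = 0) ∧
      ∀ τ z : ℂ, UHP τ →
        HasSum (fun p : ℕ × ℤ => c p.1 p.2 * eC ((p.1 : ℂ) * τ + (p.2 : ℂ) * z)) (φ τ z)

/-- Modular form of weight `k` for `SL(2,ℤ)`. -/
structure IsMF (k : ℕ) (f : ℂ → ℂ) : Prop where
  holo : DifferentiableOn ℂ f {τ | UHP τ}
  transf : ∀ M : Matrix.SpecialLinearGroup (Fin 2) ℤ, ∀ τ : ℂ, UHP τ →
      f ((Ma M * τ + Mb M) / (Mc M * τ + Md M)) = (Mc M * τ + Md M) ^ k * f τ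
  bounded : ∃ A B : ℝ, ∀ τ : ℂ, B ≤ τ.im → ‖f τ‖ ≤ A

/-- Cusp form of weight `k` for `SL(2,ℤ)`. -/
structure IsCF (k : ℕ) (f : ℂ → ℂ) : Prop where
  holo : DifferentiableOn ℂ f {τ | UHP τ}
  transf : ∀ M : Matrix.SpecialLinearGroup (Fin 2) ℤ, ∀ τ : ℂ, UHP τ →
      f ((Ma M * τ + Mb M) / (Mc M * τ + Md M)) = (Mc M * τ + Md M) ^ k * f τ
  decay : ∀ ε : ℝ, 0 < ε → ∃ B : ℝ, ∀ τ : ℂ, B ≤ τ.im → ‖f τ‖ ≤ ε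

/-- `M_w(SL(2,ℤ), ω̄)` for the character `ω` of `SL(2,ℤ)` with `ω(T) = ω(S) = i`:
holomorphic functions on the upper half plane, bounded at infinity, with
`f|_w T = -i f` and `f|_w S = -i f`. -/
structure IsMFOmegaBar (w : ℕ) (f : ℂ → ℂ) : Prop where
  holo : DifferentiableOn ℂ f {τ | UHP τ}
  transT : ∀ τ : ℂ, UHP τ → f (τ + 1) = -Complex.I * f τ
  transS : ∀ τ : ℂ, UHP τ → f (-1 / τ) = -Complex.I * τ ^ w * f τ
  bounded : ∃ A B : ℝ, ∀ τ : ℂ, B ≤ τ.im → ‖f τ‖ ≤ A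

/-- Hermitian theta function `θ^H_{m,s}` of index `m` with characteristic
`s = (a + b i)/2 ∈ O_K^♯`; the sum is over `r = s + m (g₁ + g₂ i) ∈ s + m ℤ[i]`. -/
def thetaH (m : ℕ) (a b : ℤ) (τ z₁ z₂ : ℂ) : ℂ :=
  ∑' g : ℤ × ℤ,
    eC ((((a : ℂ) + 2 * m * g.1) ^ 2 + ((b : ℂ) + 2 * m * g.2) ^ 2) / (4 * m) * τ
      + (((a : ℂ) + 2 * m * g.1) + ((b : ℂ) + 2 * m * g.2) * Complex.I) / 2 * z₁
      + (((a : ℂ) + 2 * m * g.1) - ((b : ℂ) + 2 * m * g.2) * Complex.I) / 2 * z₂)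

/-- Classical theta function `θ_{m,μ}(τ,z) = Σ_{r ≡ μ mod 2m} e(r²τ/(4m) + r z)`. -/
def thetaJ (m : ℕ) (μ : ℤ) (τ z : ℂ) : ℂ :=
  ∑' g : ℤ, eC (((μ : ℂ) + 2 * m * g) ^ 2 / (4 * m) * τ + ((μ : ℂ) + 2 * m * g) * z)

/-- `h` is the family of theta components of `φ` (for index `m`): the `h_{a,b}` depend
only on `(a, b) mod 2m` and `φ = Σ_{s ∈ O_K^♯ / m O_K} h_s θ^H_{m,s}`. -/
def HasThetaDecomp (m : ℕ) (φ : ℂ → ℂ → ℂ → ℂ) (h : ℤ → ℤ → ℂ → ℂ) : Prop :=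
  (∀ (a b : ℤ) (τ : ℂ), h (a + 2 * m) b τ = h a b τ ∧ h a (b + 2 * m) τ = h a b τ) ∧
  ∀ τ z₁ z₂ : ℂ, UHP τ →
    φ τ z₁ z₂ = ∑ a ∈ Finset.range (2 * m), ∑ b ∈ Finset.range (2 * m),
      h (a : ℤ) (b : ℤ) τ * thetaH m (a : ℤ) (b : ℤ) τ z₁ z₂

/-- `ϑ₀(τ) = Σ_{r ∈ ℤ} e(r² τ)`. -/
def theta0C (τ : ℂ) : ℂ := ∑' r : ℤ, eC ((r : ℂ) ^ 2 * τ)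

/-- `ϑ₁(τ) = Σ_{r odd} e(r² τ / 4)`. -/
def theta1C (τ : ℂ) : ℂ := ∑' r : ℤ, eC ((2 * (r : ℂ) + 1) ^ 2 * τ / 4)

/-- `ξ = ϑ₁ ϑ₀' − ϑ₀ ϑ₁'`. -/
def xiC (τ : ℂ) : ℂ := theta1C τ * deriv theta0C τ - theta0C τ * deriv theta1C τ

/-- Taylor coefficient `χ_{α,β}(τ)` of `φ(τ, z₁, z₂)` around `z₁ = z₂ = 0`. -/
def chiHJF (φ : ℂ → ℂ → ℂ → ℂ) (α β : ℕ) (τ : ℂ) : ℂ :=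
  (1 / ((α.factorial : ℂ) * (β.factorial : ℂ))) *
    iteratedDeriv α (fun z₁ => iteratedDeriv β (fun z₂ => φ τ z₁ z₂) 0) 0

/-- `D₀ : J_{k,m} → M_k`, `ψ ↦ ψ(·, 0)`. -/
def D0J (ψ : ℂ → ℂ → ℂ) : ℂ → ℂ := fun τ => ψ τ 0

/-- `D₂ : J_{k,m} → S_{k+2}`, `D₂ψ = (2k/(2πi)²) ψ₂ − (2m/(2πi)) ψ₀'`, where `ψ_ν` are
the Taylor coefficients of `ψ` around `z = 0`. -/
def D2J (k m : ℕ) (ψ : ℂ → ℂ → ℂ) : ℂ → ℂ := fun τ =>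
  (2 * (k : ℂ) / (2 * (Real.pi : ℂ) * Complex.I) ^ 2) *
      ((1 / 2) * iteratedDeriv 2 (fun z => ψ τ z) 0)
    - (2 * (m : ℂ) / (2 * (Real.pi : ℂ) * Complex.I)) * deriv (fun t => ψ t 0) τ

/-- Normalized Eisenstein series `E₄`. -/
def E4C (τ : ℂ) : ℂ :=
  1 + 240 * ∑' n : ℕ, ((ArithmeticFunction.sigma 3) n : ℂ) * eC ((n : ℂ) * τ)

/-- Normalized Eisenstein series `E₆`. -/
def E6C (τ : ℂ) : ℂ :=
  1 - 504 * ∑' n : ℕ, ((ArithmeticFunction.sigma 5) n : ℂ) * eC ((n : ℂ) * τ)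

/-- `f` agrees on the upper half plane with a polynomial in `E₄` and `E₆²` that is
homogeneous of weight `k - v`, i.e. supported on `4a + 12b + v = k`. -/
def IsE4E6sqPoly (v k : ℕ) (f : ℂ → ℂ) : Prop :=
  ∃ lam : ℕ × ℕ → ℂ, ∀ τ : ℂ, UHP τ →
    f τ = ∑ p ∈ (Finset.range (k + 1) ×ˢ Finset.range (k + 1)).filter
        (fun p => 4 * p.1 + 12 * p.2 + v = k),
      lam p * E4C τ ^ p.1 * E6C τ ^ (2 * p.2)

/-- The slash action `φ|_{k,m} M` of `M ∈ SL(2,ℤ)` on functions `ℂ → ℂ → ℂ → ℂ`. -/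
def slashHJF (k m : ℕ) (φ : ℂ → ℂ → ℂ → ℂ) (M : Matrix.SpecialLinearGroup (Fin 2) ℤ)
    (τ z₁ z₂ : ℂ) : ℂ :=
  ((Mc M * τ + Md M) ^ k)⁻¹ *
    eC (-(m : ℂ) * Mc M * z₁ * z₂ / (Mc M * τ + Md M)) *
    φ ((Ma M * τ + Mb M) / (Mc M * τ + Md M)) (z₁ / (Mc M * τ + Md M)) (z₂ / (Mc M * τ + Md M))

/-- Hermitian Jacobi form of weight `k` and index `m` for the congruence subgroup `Γ₀(N)`,
with at each cusp a Fourier expansion supported on `(n, r) ∈ ℚ_{≥0} × O_K^♯`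
with `N(r) ≤ n m`. -/
structure IsHJFLevel (k m N : ℕ) (φ : ℂ → ℂ → ℂ → ℂ) : Prop where
  holo : DifferentiableOn ℂ (fun p : ℂ × ℂ × ℂ => φ p.1 p.2.1 p.2.2) {p | UHP p.1}
  transf : ∀ ε : ℂ, ε ∈ ({1, -1, Complex.I, -Complex.I} : Set ℂ) →
    ∀ M : Matrix.SpecialLinearGroup (Fin 2) ℤ, (N : ℤ) ∣ M.1 1 0 →
    ∀ τ z₁ z₂ : ℂ, UHP τ →
      φ ((Ma M * τ + Mb M) / (Mc M * τ + Md M))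
        (ε * z₁ / (Mc M * τ + Md M))
        ((starRingEnd ℂ) ε * z₂ / (Mc M * τ + Md M))
      = ε ^ k * (Mc M * τ + Md M) ^ k *
          eC ((m : ℂ) * Mc M * z₁ * z₂ / (Mc M * τ + Md M)) * φ τ z₁ z₂
  ellip : ∀ p q u v : ℤ, ∀ τ z₁ z₂ : ℂ, UHP τ →
      φ τ (z₁ + ((p : ℂ) + (q : ℂ) * Complex.I) * τ + ((u : ℂ) + (v : ℂ) * Complex.I))
          (z₂ + ((p : ℂ) - (q : ℂ) * Complex.I) * τ + ((u : ℂ) - (v : ℂ) * Complex.I))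
      = eC (-(m : ℂ) * (((p : ℂ) ^ 2 + (q : ℂ) ^ 2) * τ
          + ((p : ℂ) - (q : ℂ) * Complex.I) * z₁
          + ((p : ℂ) + (q : ℂ) * Complex.I) * z₂)) * φ τ z₁ z₂
  cusp : ∀ M : Matrix.SpecialLinearGroup (Fin 2) ℤ,
      ∃ c : ℚ → ℤ → ℤ → ℂ,
        (∀ (n : ℚ) (a b : ℤ),
          ¬ (0 ≤ n ∧ ((a : ℚ) ^ 2 + (b : ℚ) ^ 2) ≤ 4 * n * m) → c n a b = 0) ∧
        ∀ τ z₁ z₂ : ℂ, UHP τ →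
          HasSum (fun p : ℚ × ℤ × ℤ => c p.1 p.2.1 p.2.2 *
            eC ((p.1 : ℂ) * τ + (((p.2.1 : ℂ) + (p.2.2 : ℂ) * Complex.I) / 2) * z₁
              + (((p.2.1 : ℂ) - (p.2.2 : ℂ) * Complex.I) / 2) * z₂))
            (slashHJF k m φ M τ z₁ z₂)

/-- Theta constant `x`. -/
def thConstX (τ : ℂ) : ℂ := ∑' n : ℤ, eC ((n : ℂ) ^ 2 * τ / 2)

/-- Theta constant `y`. -/
def thConstY (τ : ℂ) : ℂ := ∑' n : ℤ, (-1 : ℂ) ^ n * eC ((n : ℂ) ^ 2 * τ / 2)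

/-- Theta constant `z`. -/
def thConstZ (τ : ℂ) : ℂ := ∑' n : ℤ, eC (((n : ℂ) + 1 / 2) ^ 2 * τ / 2)

lemma hasSum_cg {ι : Type*} {f g : ι → ℂ} {a b : ℂ} (h : HasSum f a) (hfg : ∀ i, g i = f i)
    (hab : b = a) : HasSum g b := by
  subst hab; exact (funext hfg : g = f) ▸ h

lemma eC_add (a b : ℂ) : eC (a + b) = eC a * eC b := by
  unfold eC; rw [← Complex.exp_add]; congr 1; ring
lemma eC_zero : eC 0 = 1 := by simp [eC]
lemma eC_ne_zero (a : ℂ) : eC a ≠ 0 := Complex.exp_ne_zero _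
lemma eC_int (n : ℤ) : eC (n : ℂ) = 1 := by
  unfold eC; rw [Complex.exp_eq_one_iff]; exact ⟨n, by ring⟩
lemma eC_add_int (a : ℂ) (n : ℤ) : eC (a + n) = eC a := by rw [eC_add, eC_int, mul_one]
lemma eC_neg (a : ℂ) : eC (-a) = (eC a)⁻¹ := by
  rw [← mul_eq_one_iff_eq_inv₀ (eC_ne_zero _), ← eC_add]; simp [eC_zero]
lemma eC_half : eC (1 / 2) = -1 := by
  unfold eC; rw [← Complex.exp_pi_mul_I]; congr 1; ring
lemma eC_differentiable : Differentiable ℂ eC := by unfold eC; fun_prop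
lemma eC_nat_mul (n : ℕ) (a : ℂ) : eC (n * a) = eC a ^ n := by
  unfold eC; rw [← Complex.exp_nat_mul]; congr 1; ring

lemma norm_eC_real (x : ℝ) : ‖eC x‖ = 1 := by
  unfold eC
  rw [show 2 * (Real.pi : ℂ) * I * x = ((2 * Real.pi * x : ℝ) : ℂ) * I by push_cast; ring]
  exact Complex.norm_exp_ofReal_mul_I _

lemma integral_eC (m : ℤ) : ∫ x in (0:ℝ)..1, eC ((m : ℂ) * x) = if m = 0 then 1 else 0 := by
  split_ifs with h
  · subst h; simp [eC_zero]
  · have hm : (2 * (Real.pi : ℂ) * I * m) ≠ 0 := by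
      have : (m : ℂ) ≠ 0 := by exact_mod_cast h
      have : (Real.pi : ℂ) ≠ 0 := by exact_mod_cast Real.pi_ne_zero
      simp [*]
    have : (fun x : ℝ => eC ((m : ℂ) * x)) = fun x : ℝ => Complex.exp ((2 * (Real.pi : ℂ) * I * m) * x) := by
      funext x; unfold eC; congr 1; ring
    rw [this, integral_exp_mul_complex hm]
    have := eC_int m
    unfold eC at this
    simp [this]

/-- uniqueness of Fourier coefficients -/
lemma fourier_unique (g : ℤ → ℂ) (h : ∀ x : ℂ, HasSum (fun r : ℤ => g r * eC ((r : ℂ) * x)) 0) :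
    ∀ r, g r = 0 := by
  intro s
  have hs : Summable g := by
    have := (h 0).summable
    simpa [eC_zero] using this
  let f : ℤ → C(ℝ, ℂ) := fun r => ⟨fun x => g r * eC (((r - s : ℤ) : ℂ) * x), by
    have := eC_differentiable.continuous
    fun_prop⟩
  have hn : Summable fun i : ℤ => ‖(f i).restrict (⟨Set.uIcc (0:ℝ) 1, isCompact_uIcc⟩ : TopologicalSpace.Compacts ℝ)‖ := by
    refine Summable.of_nonneg_of_le (fun _ => norm_nonneg _) (fun r => ?_) hs.norm
    rw [ContinuousMap.norm_le _ (norm_nonneg _)]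
    intro x
    simp only [ContinuousMap.restrict_apply, f, ContinuousMap.coe_mk, norm_mul]
    rw [show (((r - s : ℤ) : ℂ) * ((x : ℝ) : ℂ)) = (((r - s : ℤ) * (x : ℝ) : ℝ) : ℂ) by push_cast; ring, norm_eC_real, mul_one]
  have h1 := intervalIntegral.hasSum_intervalIntegral_of_summable_norm hn
  have h2 : ∀ x : ℝ, ∑' i : ℤ, f i x = 0 := by
    intro x
    have := ((h x).mul_right (eC (-(s : ℂ) * x))).tsum_eq
    rw [zero_mul] at this
    rw [← this]
    refine tsum_congr fun r => ?_
    simp only [f, ContinuousMap.coe_mk]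
    rw [mul_assoc, ← eC_add]; congr 2; push_cast; ring
  simp only [h2] at h1
  have h3 : ∀ i : ℤ, ∫ x in (0:ℝ)..1, f i x = if i = s then g s else 0 := by
    intro i
    simp only [f, ContinuousMap.coe_mk]
    rw [intervalIntegral.integral_const_mul, integral_eC]
    by_cases hi : i = s
    · simp [hi]
    · simp [hi, sub_eq_zero]
  simp only [h3] at h1
  have := h1.unique (hasSum_ite_eq s (g s))
  simpa using this.symm

/-- push a sum forward along a map -/
lemma hasSum_push {ι κ : Type} {P : Type*} (f : ι → κ) (c : ι → ℂ) (E : κ → P → ℂ)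
    (D : Set P) (F : P → ℂ)
    (h : ∀ p ∈ D, HasSum (fun i => c i * E (f i) p) (F p)) :
    ∀ p ∈ D, HasSum (fun k => (∑' i : {i // f i = k}, c i) * E k p) (F p) := by
  intro p hp
  have h1 : HasSum ((fun i => c i * E (f i) p) ∘ (Equiv.sigmaFiberEquiv f)) (F p) :=
    (Equiv.hasSum_iff _).2 (h p hp)
  have h2 : ∀ k, (∑' i : {i // f i = k}, c i * E (f i) p) = (∑' i : {i // f i = k}, c i) * E k p := by
    intro k
    rw [← tsum_mul_right]
    exact tsum_congr fun i => by rw [i.2]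
  refine h1.sigma (fun k => ?_)
  rw [← h2]
  exact (h1.summable.sigma_factor k).hasSum

lemma coef_unique (C C' : ℤ → ℂ) (f : ℂ → ℂ)
    (h : ∀ x, HasSum (fun r : ℤ => C r * eC ((r : ℂ) * x)) (f x))
    (h' : ∀ x, HasSum (fun r : ℤ => C' r * eC ((r : ℂ) * x)) (f x)) : ∀ r, C r = C' r := by
  intro r
  refine sub_eq_zero.1 (fourier_unique (fun r => C r - C' r) (fun x => ?_) r)
  simpa [sub_mul] using (h x).sub (h' x)

lemma theta_coef (m : ℤ) (C : ℤ → ℂ) (f : ℂ → ℂ) (τ : ℂ)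
    (h : ∀ x, HasSum (fun r : ℤ => C r * eC ((r : ℂ) * x)) (f x))
    (hf : ∀ x, f (x + τ) = eC (-(m : ℂ) * (τ + 2 * x)) * f x) :
    ∀ r, C (r + 2 * m) = eC (((r : ℂ) + m) * τ) * C r := by
  refine coef_unique _ _ (fun x => f x * eC (-(2 * m : ℂ) * x)) (fun x => ?_) (fun x => ?_)
  · have := ((Equiv.addRight (2 * m)).hasSum_iff.2 (h x)).mul_right (eC (-(2 * m : ℂ) * x))
    refine this.congr_fun fun r => ?_
    simp only [Function.comp, Equiv.coe_addRight]
    rw [mul_assoc, ← eC_add]; congr 2; push_cast; ring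
  · have := (h (x + τ)).mul_right (eC ((m : ℂ) * τ))
    rw [hf] at this
    refine hasSum_cg this (fun r => ?_) ?_
    · rw [mul_comm (eC _) (C r), mul_assoc, mul_assoc, ← eC_add, ← eC_add]; congr 2; ring
    · rw [mul_comm (eC _) (f x), mul_assoc, ← eC_add]; congr 2; ring

lemma odd_coef (C : ℤ → ℂ) (f : ℂ → ℂ)
    (h : ∀ x, HasSum (fun r : ℤ => C r * eC ((r : ℂ) * x)) (f x))
    (hf : ∀ x, f (-x) = - f x) : ∀ r, C (-r) = - C r := by
  refine coef_unique _ _ (fun x => f (-x)) (fun x => ?_) (fun x => ?_)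
  · have := (Equiv.neg ℤ).hasSum_iff.2 (h (-x))
    refine this.congr_fun fun r => ?_
    simp
  · rw [hf]
    simpa using (h x).neg

/-- an odd theta function of index 2 with vanishing first coefficient is zero -/
lemma odd_index_two (C : ℤ → ℂ) (f : ℂ → ℂ) (τ : ℂ)
    (h : ∀ x, HasSum (fun r : ℤ => C r * eC ((r : ℂ) * x)) (f x))
    (hf : ∀ x, f (x + τ) = eC (-2 * (τ + 2 * x)) * f x)
    (ho : ∀ x, f (-x) = - f x) (h1 : C 1 = 0) : ∀ x, f x = 0 := by
  have hs := theta_coef 2 C f τ h (by simpa using hf)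
  have hn := odd_coef C f h ho
  have hz : ∀ r, C (r + 4) = 0 ↔ C r = 0 := fun r => by
    have := hs r; norm_num at this; rw [this]; simp [eC_ne_zero]
  have h0 : C 0 = 0 := by
    have := hn 0; simp at this; exact self_eq_neg.1 this
  have h2 : C 2 = 0 := by
    have a := hs (-2); have b := hn 2
    norm_num [eC_zero] at a b
    rw [b] at a; exact self_eq_neg.1 a
  have h3 : C 3 = 0 := by
    have := hz (-1); norm_num at this; rw [this, hn, h1, neg_zero]
  have hall : ∀ n s : ℤ, C (s + 4 * n) = 0 ↔ C s = 0 := by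
    intro n s
    induction n using Int.induction_on with
    | zero => simp
    | succ n ih => rw [← ih, ← hz (s + 4 * n)]; ring_nf
    | pred n ih => rw [← ih, ← hz (s + 4 * (-n - 1))]; ring_nf
  have hC : ∀ r, C r = 0 := by
    intro r
    have e : r = r % 4 + 4 * (r / 4) := by omega
    rw [e, hall]
    have : r % 4 = 0 ∨ r % 4 = 1 ∨ r % 4 = 2 ∨ r % 4 = 3 := by omega
    rcases this with h | h | h | h <;> rw [h] <;> assumption
  intro x
  have := h x
  simp only [hC, zero_mul] at this
  exact this.unique hasSum_zero

/-- an odd theta function of index 4 has no coefficients at multiples of 4 -/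
lemma odd_index_four (C : ℤ → ℂ) (f : ℂ → ℂ) (τ : ℂ)
    (h : ∀ x, HasSum (fun r : ℤ => C r * eC ((r : ℂ) * x)) (f x))
    (hf : ∀ x, f (x + τ) = eC (-4 * (τ + 2 * x)) * f x)
    (ho : ∀ x, f (-x) = - f x) : ∀ s, C (4 * s) = 0 := by
  have hs := theta_coef 4 C f τ h (by simpa using hf)
  have hn := odd_coef C f h ho
  have hz : ∀ r, C (r + 8) = 0 ↔ C r = 0 := fun r => by
    have := hs r; norm_num at this; rw [this]; simp [eC_ne_zero]
  have h0 : C 0 = 0 := by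
    have := hn 0; simp at this; exact self_eq_neg.1 this
  have h2 : C 4 = 0 := by
    have a := hs (-4); have b := hn 4
    norm_num [eC_zero] at a b
    rw [b] at a; exact self_eq_neg.1 a
  have hall : ∀ n s : ℤ, C (s + 8 * n) = 0 ↔ C s = 0 := by
    intro n s
    induction n using Int.induction_on with
    | zero => simp
    | succ n ih => rw [← ih, ← hz (s + 8 * n)]; ring_nf
    | pred n ih => rw [← ih, ← hz (s + 8 * (-n - 1))]; ring_nf
  intro s
  have e : 4 * s = 4 * (s % 2) + 8 * (s / 2) := by omega
  rw [e, hall]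
  have : s % 2 = 0 ∨ s % 2 = 1 := by omega
  rcases this with h | h <;> rw [h] <;> simpa

lemma hasSum_push' {ι κ : Type} {P : Type*} (f : ι → κ) (c : ι → ℂ) (E : κ → P → ℂ)
    (D : Set P) (F : P → ℂ) (S : Set κ) (hS : ∀ i, f i ∉ S → c i = 0)
    (h : ∀ p ∈ D, HasSum (fun i => c i * E (f i) p) (F p)) :
    ∃ d : κ → ℂ, (∀ k, k ∉ S → d k = 0) ∧ ∀ p ∈ D, HasSum (fun k => d k * E k p) (F p) := by
  refine ⟨_, fun k hk => ?_, hasSum_push f c E D F h⟩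
  have : ∀ i : {i // f i = k}, c i = 0 := fun i => hS i (by rw [i.2]; exact hk)
  simp [this]

lemma mul_entire {f g : ℂ → ℂ} (hf : Differentiable ℂ f) (hg : Differentiable ℂ g)
    (h : ∀ x, f x * g x = 0) : (∀ x, f x = 0) ∨ (∀ x, g x = 0) := by
  have := AnalyticOnNhd.eq_zero_or_eq_zero_of_mul_eq_zero (U := Set.univ)
    (Complex.analyticOnNhd_univ_iff_differentiable.2 hf)
    (Complex.analyticOnNhd_univ_iff_differentiable.2 hg) (fun x _ => h x) isPreconnected_univ
  simpa using this

lemma kernel_zero (τ : ℂ) (F : ℂ → ℂ → ℂ)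
    (hd1 : ∀ y, Differentiable ℂ (fun x => F x y)) (hd2 : ∀ x, Differentiable ℂ (fun y => F x y))
    (hF : ∀ y, ∃ C : ℤ → ℂ, ∀ x, HasSum (fun r : ℤ => C r * eC ((r : ℂ) * x)) (F x y))
    (ell : ∀ x y, F (x + τ) y = eC (-2 * (τ + 2 * x)) * F x y)
    (rot : ∀ x y, F (-y) x = I * F x y) (diag : ∀ z, F z z = 0) : ∀ x y, F x y = 0 := by
  have odd : ∀ x y, F (-x) (-y) = - F x y := by
    intro x y
    rw [rot, rot, ← mul_assoc, I_mul_I]; ring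
  choose C hC using hF
  let g : ℂ → ℂ → ℂ := fun x y => F x y - F (-x) y
  let G : ℂ → ℤ → ℂ := fun y r => C y r - C y (-r)
  have hG : ∀ y x, HasSum (fun r : ℤ => G y r * eC ((r : ℂ) * x)) (g x y) := by
    intro y x
    have h2 := (Equiv.neg ℤ).hasSum_iff.2 (hC y (-x))
    refine hasSum_cg ((hC y x).sub h2) (fun r => ?_) rfl
    simp [G, sub_mul]
  have gell : ∀ y x, g (x + τ) y = eC (-2 * (τ + 2 * x)) * g x y := by
    intro y x
    have h1 := ell (-(x + τ)) y
    rw [show -(x + τ) + τ = -x by ring] at h1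
    simp only [g]
    rw [ell, h1, mul_sub, ← mul_assoc, ← eC_add]
    ring_nf
    simp [eC_zero]
  have godd : ∀ y x, g (-x) y = - g x y := by intro y x; simp [g]
  have gdiag : ∀ z, g z z = 0 := by intro z; simp [g, diag, rot]
  have claim : ∀ x y y', G y' 1 * g x y - G y 1 * g x y' = 0 := by
    intro x y y'
    refine odd_index_two (fun r => G y' 1 * G y r - G y 1 * G y' r)
      (fun x => G y' 1 * g x y - G y 1 * g x y') τ (fun x => ?_) (fun x => ?_) (fun x => ?_) (by ring) x
    · refine hasSum_cg (((hG y x).mul_left (G y' 1)).sub ((hG y' x).mul_left (G y 1))) (fun r => by ring) rfl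
    · simp only [gell]; ring
    · simp only [godd]; ring
  have gz : ∀ x y, g x y = 0 := by
    by_contra hne
    push Not at hne
    obtain ⟨x0, y0, h0⟩ := hne
    have hG0 : G y0 1 ≠ 0 := fun hh => h0 (odd_index_two (G y0) (fun x => g x y0) τ (hG y0) (gell y0) (godd y0) hh x0)
    have hm : ∀ y, g x0 y * g y y0 = 0 := by
      intro y
      have a := claim y y y0
      have b := claim x0 y y0
      rw [gdiag, mul_zero, zero_sub, neg_eq_zero] at a
      have : G y0 1 * (g x0 y * g y y0) = 0 := by
        linear_combination g y y0 * b + g x0 y0 * a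
      exact (mul_eq_zero.1 this).resolve_left hG0
    have d1 : Differentiable ℂ (fun y => g x0 y) := by
      simp only [g]; exact (hd2 _).sub (hd2 _)
    have d2 : Differentiable ℂ (fun x => g x y0) := by
      simp only [g]; exact (hd1 _).sub ((hd1 _).comp differentiable_neg)
    rcases mul_entire d1 d2 hm with h | h
    · exact h0 (h y0)
    · exact h0 (h x0)
  have ev : ∀ x y, F (-x) y = F x y := fun x y => (sub_eq_zero.1 (gz x y)).symm
  have ev2 : ∀ x y, F x (-y) = F x y := by
    intro x y
    have h1 := rot (-y) (-x)
    have h2 := odd y x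
    have h3 := ev y x
    have h4 := rot x y
    rw [neg_neg] at h1
    linear_combination h1 + I * h2 + I * h3 - I * h4 - F x y * I_mul_I
  intro x y
  have := odd x y
  rw [ev, ev2] at this
  exact self_eq_neg.1 this

lemma HJF_props (k : ℕ) (hk4 : k % 4 = 1) (φ : ℂ → ℂ → ℂ → ℂ) (h : IsHJF k 2 φ) (τ : ℂ) (hτ : UHP τ) :
    (∀ y, Differentiable ℂ (fun x => φ τ (x + I * y) (x - I * y))) ∧
    (∀ x, Differentiable ℂ (fun y => φ τ (x + I * y) (x - I * y))) ∧
    (∀ y, ∃ C : ℤ → ℂ, ∀ x, HasSum (fun r : ℤ => C r * eC ((r : ℂ) * x)) (φ τ (x + I * y) (x - I * y))) ∧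
    (∀ x y, φ τ (x + τ + I * y) (x + τ - I * y) = eC (-2 * (τ + 2 * x)) * φ τ (x + I * y) (x - I * y)) ∧
    (∀ x y, φ τ (-y + I * x) (-y - I * x) = I * φ τ (x + I * y) (x - I * y)) := by
  have hd : ∀ p : ℂ × ℂ × ℂ, UHP p.1 → DifferentiableAt ℂ (fun p : ℂ × ℂ × ℂ => φ p.1 p.2.1 p.2.2) p := by
    intro p hp
    exact h.holo.differentiableAt ((isOpen_lt continuous_const (by fun_prop : Continuous fun p : ℂ × ℂ × ℂ => p.1.im)).mem_nhds hp)
  refine ⟨fun y x => ?_, fun x y => ?_, fun y => ?_, fun x y => ?_, fun x y => ?_⟩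
  · exact (hd (τ, x + I * y, x - I * y) hτ).comp x (f := fun x => (τ, x + I * y, x - I * y)) (by fun_prop)
  · exact (hd (τ, x + I * y, x - I * y) hτ).comp y (f := fun y => (τ, x + I * y, x - I * y)) (by fun_prop)
  · obtain ⟨c, -, hc⟩ := h.fourier
    obtain ⟨d, -, hd⟩ := hasSum_push' (ι := ℕ × ℤ × ℤ) (κ := ℤ) (P := ℂ) (fun i => i.2.1)
      (fun i => c i.1 i.2.1 i.2.2 * eC (i.1 * τ - i.2.2 * y)) (fun r x => eC (r * x)) Set.univ
      (fun x => φ τ (x + I * y) (x - I * y)) Set.univ (by simp) (fun x _ => by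
        refine hasSum_cg (hc τ (x + I * y) (x - I * y) hτ) (fun i => ?_) rfl
        rw [mul_assoc, ← eC_add]; congr 2
        linear_combination (-(i.2.2 : ℂ) * y) * I_mul_I)
    exact ⟨d, fun x => hd x trivial⟩
  · have := h.ellip 1 0 0 0 τ (x + I * y) (x - I * y) hτ
    simp only [Int.cast_one, Int.cast_zero, zero_mul, add_zero, sub_zero, one_mul] at this
    rw [show x + τ + I * y = x + I * y + τ by ring, show x + τ - I * y = x - I * y + τ by ring, this]
    congr 2; push_cast; ring
  · have := h.transf I (by simp) 1 τ (x + I * y) (x - I * y) hτ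
    have hI : I ^ k = I := by
      rw [← Nat.div_add_mod k 4, hk4, pow_add, pow_mul, I_pow_four]; simp
    simp [Ma, Mb, Mc, Md, eC_zero, hI] at this
    rw [← this]; congr 1
    · linear_combination (-y) * I_mul_I
    · linear_combination (-y) * I_mul_I

lemma part2 (k : ℕ) (hk4 : k % 4 = 1) (φ φ' : ℂ → ℂ → ℂ → ℂ) (h : IsHJF k 2 φ) (h' : IsHJF k 2 φ')
    (he : ∀ τ z : ℂ, UHP τ →
        φ τ ((1 + Complex.I) * z) ((1 - Complex.I) * z)
          = φ' τ ((1 + Complex.I) * z) ((1 - Complex.I) * z)) :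
      ∀ τ z₁ z₂ : ℂ, UHP τ → φ τ z₁ z₂ = φ' τ z₁ z₂ := by
  intro τ z₁ z₂ hτ
  obtain ⟨a1, a2, a3, a4, a5⟩ := HJF_props k hk4 φ h τ hτ
  obtain ⟨b1, b2, b3, b4, b5⟩ := HJF_props k hk4 φ' h' τ hτ
  have := kernel_zero τ (fun x y => φ τ (x + I * y) (x - I * y) - φ' τ (x + I * y) (x - I * y))
    (fun y => (a1 y).sub (b1 y)) (fun x => (a2 x).sub (b2 x)) (fun y => by
      obtain ⟨C, hC⟩ := a3 y
      obtain ⟨C', hC'⟩ := b3 y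
      exact ⟨fun r => C r - C' r, fun x => hasSum_cg ((hC x).sub (hC' x)) (fun r => by ring) rfl⟩)
    (fun x y => by simp only [a4, b4]; ring) (fun x y => by simp only [a5, b5]; ring)
    (fun z => by
      rw [show z + I * z = (1 + I) * z by ring, show z - I * z = (1 - I) * z by ring, he τ z hτ, sub_self])
    ((z₁ + z₂) / 2) (-I * (z₁ - z₂) / 2)
  have e1 : (z₁ + z₂) / 2 + I * (-I * (z₁ - z₂) / 2) = z₁ := by
    linear_combination (-(z₁ - z₂) / 2) * I_mul_I
  have e2 : (z₁ + z₂) / 2 - I * (-I * (z₁ - z₂) / 2) = z₂ := by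
    linear_combination ((z₁ - z₂) / 2) * I_mul_I
  simp only [e1, e2] at this
  exact sub_eq_zero.1 this

lemma part1 (k : ℕ) (φ : ℂ → ℂ → ℂ → ℂ) (h : IsHJF k 2 φ) :
      IsJF k 4 (fun τ z => φ τ ((1 + Complex.I) * z) ((1 - Complex.I) * z)) := by
  have e2 : ∀ z : ℂ, (1 + I) * z * ((1 - I) * z) = 2 * z ^ 2 := by
    intro z; linear_combination (-z ^ 2) * I_mul_I
  refine ⟨?_, fun M τ z hτ => ?_, fun p q τ z hτ => ?_, ?_⟩
  · exact h.holo.comp (f := fun p : ℂ × ℂ => (p.1, (1 + I) * p.2, (1 - I) * p.2)) (by fun_prop) (fun p hp => hp)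
  · have := h.transf 1 (by simp) M τ ((1 + I) * z) ((1 - I) * z) hτ
    simp only [map_one, one_mul, one_pow] at this
    rw [mul_div_assoc, mul_div_assoc] at this
    rw [this]; congr 3
    push_cast
    rw [mul_assoc (2 * Mc M), e2]; ring
  · have := h.ellip p p q q τ ((1 + I) * z) ((1 - I) * z) hτ
    rw [show (1 + I) * (z + p * τ + q) = (1 + I) * z + (p + p * I) * τ + (q + q * I) by ring,
      show (1 - I) * (z + p * τ + q) = (1 - I) * z + (p - p * I) * τ + (q - q * I) by ring, this]
    congr 2
    push_cast
    linear_combination (4 * p * z) * I_mul_I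
  · obtain ⟨c, hc0, hc⟩ := h.fourier
    obtain ⟨d, hd0, hd⟩ := hasSum_push' (ι := ℕ × ℤ × ℤ) (κ := ℕ × ℤ) (P := ℂ × ℂ)
      (fun i => (i.1, i.2.1 - i.2.2))
      (fun i => c i.1 i.2.1 i.2.2) (fun r x => eC (r.1 * x.1 + r.2 * x.2)) {p | UHP p.1}
      (fun x => φ x.1 ((1 + I) * x.2) ((1 - I) * x.2)) {p | p.2 ^ 2 ≤ 16 * p.1}
      (fun i hi => hc0 _ _ _ (by
        simp only [Set.mem_ofPred_eq, not_le] at hi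
        push_cast
        nlinarith [sq_nonneg (i.2.1 + i.2.2)])) (fun x hx => by
        refine hasSum_cg (hc x.1 ((1 + I) * x.2) ((1 - I) * x.2) hx) (fun i => ?_) rfl
        congr 2
        push_cast
        linear_combination (-(i.2.2 : ℂ) * x.2) * I_mul_I)
    refine ⟨fun n r => d (n, r), fun n r hr => hd0 _ ?_, fun τ z hτ => hd (τ, z) hτ⟩
    simp only [Set.mem_ofPred_eq, not_le]
    push_cast at hr; linarith

lemma th_term (n : ℤ) (z τ : ℂ) : jacobiTheta₂_term n z τ = eC (n * z + n ^ 2 * τ / 2) := by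
  unfold jacobiTheta₂_term eC; congr 1; ring
lemma th_hasSum (z : ℂ) {τ : ℂ} (hτ : UHP τ) :
    HasSum (fun n : ℤ => eC (n * z + n ^ 2 * τ / 2)) (jacobiTheta₂ z τ) := by
  have := hasSum_jacobiTheta₂_term z hτ
  simpa only [th_term] using this
lemma th_tau (z τ : ℂ) : jacobiTheta₂ (z + τ) τ = eC (-(τ / 2) - z) * jacobiTheta₂ z τ := by
  rw [jacobiTheta₂_add_left']; unfold eC; congr 2; ring
lemma th_T (z τ : ℂ) : jacobiTheta₂ z (τ + 1) = jacobiTheta₂ (z + 1 / 2) τ := by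
  unfold jacobiTheta₂
  refine tsum_congr fun n => ?_
  rw [th_term, th_term]
  obtain ⟨m, hm⟩ := Int.even_mul_succ_self (n - 1)
  have hm' : ((n : ℂ) - 1) * n = m + m := by
    have : (n - 1) * n = m + m := by rw [← hm]; ring
    exact_mod_cast this
  rw [← eC_add_int (n * (z + 1 / 2) + n ^ 2 * τ / 2) m]
  congr 1
  linear_combination hm' / 2
lemma UHP.ne {τ : ℂ} (h : UHP τ) : τ ≠ 0 := by
  rintro rfl; simp [UHP] at h
lemma UHP.neg_inv {τ : ℂ} (h : UHP τ) : UHP (-1 / τ) := by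
  unfold UHP at *
  rw [neg_div, one_div, neg_im, inv_im]
  have := normSq_pos.2 (UHP.ne h)
  rw [neg_div, neg_neg]; positivity
lemma UHP.add_one {τ : ℂ} (h : UHP τ) : UHP (τ + 1) := by simpa [UHP] using h
lemma th_S (z : ℂ) {τ : ℂ} (hτ : UHP τ) :
    jacobiTheta₂ (z / τ) (-1 / τ) ^ 2 = (-I * τ) * eC (z ^ 2 / τ) * jacobiTheta₂ z τ ^ 2 := by
  have h := jacobiTheta₂_functional_equation z τ
  have hI : -I * τ ≠ 0 := mul_ne_zero (by simp) hτ.ne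
  have hs : ((-I * τ) ^ (1 / 2 : ℂ)) ^ 2 = -I * τ := by
    rw [← cpow_nat_mul]; simp
  have he : cexp (-Real.pi * I * z ^ 2 / τ) ^ 2 = eC (-(z ^ 2 / τ)) := by
    rw [← Complex.exp_nat_mul]; unfold eC; congr 1; push_cast; ring
  rw [h, mul_pow, mul_pow, div_pow, hs, he, eC_neg]
  have := eC_ne_zero (z ^ 2 / τ)
  have h0 := hτ.ne
  generalize jacobiTheta₂ (z / τ) (-1 / τ) = X
  generalize eC (z ^ 2 / τ) = Y at *
  field_simp

lemma th_entire {τ : ℂ} (hτ : UHP τ) : Differentiable ℂ (fun z => jacobiTheta₂ z τ) :=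
  fun z => differentiableAt_jacobiTheta₂_fst z hτ

lemma pair_bij : Function.Bijective (fun s : (ℤ × ℤ) ⊕ (ℤ × ℤ) =>
    Sum.elim (fun p => (p.1 + p.2, p.1 - p.2)) (fun p => (p.1 + p.2 + 1, p.1 - p.2)) s) := by
  constructor
  · rintro (⟨a, b⟩ | ⟨a, b⟩) (⟨c, d⟩ | ⟨c, d⟩) h <;> simp at h ⊢ <;> omega
  · rintro ⟨n, m⟩
    rcases Int.even_or_odd' (n + m) with ⟨c, h | h⟩
    · exact ⟨Sum.inl (c, n - c), by simp; omega⟩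
    · exact ⟨Sum.inr (c, n - c - 1), by simp; omega⟩

lemma hasSum_mul_c {ι κ : Type*} {f : ι → ℂ} {g : κ → ℂ} {a b : ℂ} (hf : HasSum f a) (hg : HasSum g b) :
    HasSum (fun p : ι × κ => f p.1 * g p.2) (a * b) :=
  hf.mul hg (summable_mul_of_summable_norm hf.summable.norm hg.summable.norm)

lemma th_identity {τ : ℂ} (hτ : UHP τ) (x : ℂ) :
    jacobiTheta₂ (2 * x) τ * jacobiTheta₂ 0 τ =
      jacobiTheta₂ (2 * x) (2 * τ) ^ 2 + (eC (τ / 4 + x) * jacobiTheta₂ (2 * x + τ) (2 * τ)) ^ 2 := by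
  have h2 : UHP (2 * τ) := by unfold UHP at *; simpa using hτ
  have hA := th_hasSum (2 * x) h2
  have hB := (th_hasSum (2 * x + τ) h2).mul_left (eC (τ / 4 + x))
  have hL := hasSum_mul_c (th_hasSum (2 * x) hτ) (th_hasSum 0 hτ)
  have hL' := (Equiv.ofBijective _ pair_bij).hasSum_iff.2 hL
  have hAA := hasSum_mul_c hA hA
  have hBB := hasSum_mul_c hB hB
  refine hL'.unique ?_
  rw [sq, sq]
  refine HasSum.sum (hasSum_cg hAA (fun p => ?_) rfl) (hasSum_cg hBB (fun p => ?_) rfl)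
  · simp only [Function.comp, Equiv.ofBijective_apply, Sum.elim_inl, ← eC_add]
    congr 1; push_cast; ring
  · simp only [Function.comp, Equiv.ofBijective_apply, Sum.elim_inr, ← eC_add]
    congr 1; push_cast; ring

lemma th_zero_ne {τ : ℂ} (hτ : UHP τ) : jacobiTheta₂ 0 τ ≠ 0 := by
  intro h0
  have h2 : UHP (2 * τ) := by unfold UHP at *; simpa using hτ
  set A : ℂ → ℂ := fun x => jacobiTheta₂ (2 * x) (2 * τ) with hA
  set B : ℂ → ℂ := fun x => eC (τ / 4 + x) * jacobiTheta₂ (2 * x + τ) (2 * τ) with hB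
  have dA : Differentiable ℂ A := (th_entire h2).comp (by fun_prop : Differentiable ℂ fun x : ℂ => 2 * x)
  have dB : Differentiable ℂ B := (eC_differentiable.comp (by fun_prop : Differentiable ℂ fun x : ℂ => τ / 4 + x)).mul
    ((th_entire h2).comp (by fun_prop : Differentiable ℂ fun x : ℂ => 2 * x + τ))
  have hAB : ∀ x, (A x + I * B x) * (A x - I * B x) = 0 := by
    intro x
    have := th_identity hτ x
    rw [h0, mul_zero] at this
    simp only [hA, hB]
    linear_combination -this - (eC (τ / 4 + x) * jacobiTheta₂ (2 * x + τ) (2 * τ)) ^ 2 * I_mul_I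
  have sA : ∀ x, A (x + 1 / 2) = A x := by
    intro x; simp only [hA]
    rw [show 2 * (x + 1 / 2) = 2 * x + 1 by ring, jacobiTheta₂_add_left]
  have sB : ∀ x, B (x + 1 / 2) = - B x := by
    intro x; simp only [hB]
    rw [show 2 * (x + 1 / 2) + τ = 2 * x + τ + 1 by ring, jacobiTheta₂_add_left,
      ← add_assoc, eC_add _ (1 / 2), eC_half]; ring
  have hA0 : ∀ x, A x = 0 := by
    rcases mul_entire (dA.add (dB.const_mul I)) (dA.sub (dB.const_mul I)) hAB with h | h
    · intro x
      have a := h x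
      have b := h (x + 1 / 2)
      simp only [Pi.add_apply, sA, sB] at a b
      linear_combination (a + b) / 2
    · intro x
      have a := h x
      have b := h (x + 1 / 2)
      simp only [Pi.sub_apply, sA, sB] at a b
      linear_combination (a + b) / 2
  have := fourier_unique (fun r : ℤ => eC (r ^ 2 * τ)) (fun x => by
    refine hasSum_cg (th_hasSum x h2) (fun r => ?_) ?_
    · rw [← eC_add]; congr 1; ring
    · have := hA0 (x / 2)
      simp only [hA] at this
      rw [← this]; congr 1; ring) 0
  exact eC_ne_zero _ this

lemma th_half_ne {τ : ℂ} (hτ : UHP τ) : jacobiTheta₂ (1 / 2) τ ≠ 0 := by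
  have := th_T 0 τ
  rw [zero_add] at this
  rw [← this]; exact th_zero_ne hτ.add_one

lemma th_tau2_ne {τ : ℂ} (hτ : UHP τ) : jacobiTheta₂ (τ / 2) τ ≠ 0 := by
  have h := th_half_ne hτ.neg_inv
  have h2 := th_S (τ / 2) hτ
  rw [show τ / 2 / τ = 1 / 2 by have := hτ.ne; field_simp] at h2
  intro h0
  rw [h0] at h2
  simp only [ne_eq, OfNat.ofNat_ne_zero, not_false_eq_true, zero_pow, mul_zero, pow_eq_zero_iff] at h2
  exact h h2

lemma th_odd_zero (τ : ℂ) : jacobiTheta₂ ((τ + 1) / 2) τ = 0 := by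
  have h1 := th_tau (-((τ + 1) / 2) + 1) τ
  rw [show -((τ + 1) / 2) + 1 + τ = (τ + 1) / 2 by ring, jacobiTheta₂_add_left, jacobiTheta₂_neg_left,
    show -(τ / 2) - (-((τ + 1) / 2) + 1) = 1 / 2 + ((-1 : ℤ) : ℂ) by push_cast; ring, eC_add_int, eC_half] at h1
  linear_combination h1 / 2

def R3 (τ v : ℂ) : ℂ := (jacobiTheta₂ v τ / jacobiTheta₂ 0 τ) ^ 2
def R4 (τ v : ℂ) : ℂ := (jacobiTheta₂ (v + 1 / 2) τ / jacobiTheta₂ (1 / 2) τ) ^ 2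
def R2 (τ v : ℂ) : ℂ := eC v * (jacobiTheta₂ (v + τ / 2) τ / jacobiTheta₂ (τ / 2) τ) ^ 2

lemma R3_even (τ v : ℂ) : R3 τ (-v) = R3 τ v := by unfold R3; rw [jacobiTheta₂_neg_left]
lemma R4_even (τ v : ℂ) : R4 τ (-v) = R4 τ v := by
  unfold R4; rw [← jacobiTheta₂_neg_left (-v + 1 / 2), ← jacobiTheta₂_add_left, show -(-v + 1 / 2) + 1 = v + 1 / 2 by ring]
lemma eC_two (a : ℂ) : eC (2 * a) = eC a ^ 2 := by rw [sq, ← eC_add]; congr 1; ring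
lemma R2_even (τ v : ℂ) : R2 τ (-v) = R2 τ v := by
  unfold R2; rw [← jacobiTheta₂_neg_left (-v + τ / 2)]
  have := th_tau (-(-v + τ / 2)) τ
  rw [show -(-v + τ / 2) + τ = v + τ / 2 by ring, show -(τ / 2) - -(-v + τ / 2) = -v by ring] at this
  rw [this]
  have h2 : eC v * eC (-v) = 1 := by rw [← eC_add]; simp [eC_zero]
  generalize jacobiTheta₂ (-(-v + τ / 2)) τ = X
  generalize jacobiTheta₂ (τ / 2) τ = Y
  linear_combination (-eC (-v) * (X / Y) ^ 2) * h2
lemma R3_one (τ v : ℂ) : R3 τ (v + 1) = R3 τ v := by unfold R3; rw [jacobiTheta₂_add_left]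
lemma R4_one (τ v : ℂ) : R4 τ (v + 1) = R4 τ v := by
  unfold R4; rw [show v + 1 + 1 / 2 = v + 1 / 2 + 1 by ring, jacobiTheta₂_add_left]
lemma R2_one (τ v : ℂ) : R2 τ (v + 1) = R2 τ v := by
  unfold R2; rw [show v + 1 + τ / 2 = v + τ / 2 + 1 by ring, jacobiTheta₂_add_left]
  have := eC_add_int v 1
  rw [Int.cast_one] at this; rw [this]
lemma R3_tau (τ v : ℂ) : R3 τ (v + τ) = eC (-(τ + 2 * v)) * R3 τ v := by
  unfold R3; rw [th_tau, show -(τ + 2 * v) = 2 * (-(τ / 2) - v) by ring, eC_two]; ring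
lemma R4_tau (τ v : ℂ) : R4 τ (v + τ) = eC (-(τ + 2 * v)) * R4 τ v := by
  unfold R4
  have := eC_add_int (-(τ + 2 * v)) (-1)
  rw [show v + τ + 1 / 2 = v + 1 / 2 + τ by ring, th_tau, ← this,
    show -(τ + 2 * v) + ((-1 : ℤ) : ℂ) = 2 * (-(τ / 2) - (v + 1 / 2)) by push_cast; ring, eC_two]; ring
lemma R2_tau (τ v : ℂ) : R2 τ (v + τ) = eC (-(τ + 2 * v)) * R2 τ v := by
  unfold R2
  have e : eC (v + τ) * eC (-(τ / 2) - (v + τ / 2)) ^ 2 = eC (-(τ + 2 * v)) * eC v := by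
    rw [← eC_two, ← eC_add, ← eC_add]; congr 1; ring
  rw [show v + τ + τ / 2 = v + τ / 2 + τ by ring, th_tau]
  generalize jacobiTheta₂ (v + τ / 2) τ = X
  generalize jacobiTheta₂ (τ / 2) τ = Y
  linear_combination (X / Y) ^ 2 * e
lemma R3_T (τ v : ℂ) : R3 (τ + 1) v = R4 τ v := by unfold R3 R4; rw [th_T, th_T, zero_add]
lemma R4_T (τ v : ℂ) : R4 (τ + 1) v = R3 τ v := by
  unfold R3 R4; rw [th_T, th_T, show v + 1 / 2 + 1 / 2 = v + 1 by ring, show (1 / 2 : ℂ) + 1 / 2 = 0 + 1 by ring,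
    jacobiTheta₂_add_left, jacobiTheta₂_add_left]
lemma R2_T (τ v : ℂ) : R2 (τ + 1) v = R2 τ v := by
  unfold R2; rw [th_T, th_T, show v + (τ + 1) / 2 + 1 / 2 = v + τ / 2 + 1 by ring,
    show (τ + 1) / 2 + 1 / 2 = τ / 2 + 1 by ring, jacobiTheta₂_add_left, jacobiTheta₂_add_left]

lemma th_S_ratio (z w : ℂ) {τ : ℂ} (hτ : UHP τ) :
    (jacobiTheta₂ (z / τ) (-1 / τ) / jacobiTheta₂ (w / τ) (-1 / τ)) ^ 2
      = eC (z ^ 2 / τ - w ^ 2 / τ) * (jacobiTheta₂ z τ / jacobiTheta₂ w τ) ^ 2 := by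
  rw [div_pow, th_S z hτ, th_S w hτ, sub_eq_add_neg, eC_add, eC_neg, div_pow]
  have h1 := eC_ne_zero (w ^ 2 / τ)
  have h0 := hτ.ne
  have hI : -I * τ ≠ 0 := mul_ne_zero (by simp) hτ.ne
  generalize jacobiTheta₂ z τ = X
  generalize jacobiTheta₂ w τ = Y
  generalize eC (w ^ 2 / τ) = U at *
  generalize -I * τ = V at *
  rw [mul_assoc, mul_assoc V, mul_div_mul_left _ _ hI, mul_div_mul_comm, div_eq_mul_inv]

lemma R3_S (v : ℂ) {τ : ℂ} (hτ : UHP τ) : R3 (-1 / τ) (v / τ) = eC (v ^ 2 / τ) * R3 τ v := by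
  unfold R3
  have := th_S_ratio v 0 hτ
  simpa using this
lemma R4_S (v : ℂ) {τ : ℂ} (hτ : UHP τ) : R4 (-1 / τ) (v / τ) = eC (v ^ 2 / τ) * R2 τ v := by
  unfold R4 R2
  have := th_S_ratio (v + τ / 2) (τ / 2) hτ
  have h0 := hτ.ne
  rw [show v / τ + 1 / 2 = (v + τ / 2) / τ by field_simp]
  rw [show (τ / 2) / τ = 1 / 2 by field_simp] at this
  rw [this, ← mul_assoc, ← eC_add]; congr 2
  field_simp; ring
lemma R2_S (v : ℂ) {τ : ℂ} (hτ : UHP τ) : R2 (-1 / τ) (v / τ) = eC (v ^ 2 / τ) * R4 τ v := by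
  unfold R4 R2
  have := th_S_ratio (v - 1 / 2) (-(1 / 2)) hτ
  have h0 := hτ.ne
  rw [show v / τ + -1 / τ / 2 = (v - 1 / 2) / τ by field_simp; ring]
  rw [show (-(1 / 2 : ℂ)) / τ = -1 / τ / 2 by field_simp] at this
  rw [this, jacobiTheta₂_neg_left, show v + 1 / 2 = v - 1 / 2 + 1 by ring, jacobiTheta₂_add_left, ← mul_assoc, ← eC_add]
  congr 2
  field_simp; ring

lemma R3_zero {τ : ℂ} (hτ : UHP τ) : R3 τ 0 = 1 := by unfold R3; rw [div_self (th_zero_ne hτ)]; simp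
lemma R4_zero {τ : ℂ} (hτ : UHP τ) : R4 τ 0 = 1 := by unfold R4; rw [zero_add, div_self (th_half_ne hτ)]; simp
lemma R2_zero {τ : ℂ} (hτ : UHP τ) : R2 τ 0 = 1 := by
  unfold R2; rw [zero_add, div_self (th_tau2_ne hτ)]; simp [eC_zero]

def Kf (τ v : ℂ) : ℂ := R2 τ v * R3 τ v * R4 τ v * ((R2 τ v + R3 τ v + R4 τ v) * (1 / 3))

lemma Kf_even (τ v : ℂ) : Kf τ (-v) = Kf τ v := by unfold Kf; simp only [R2_even, R3_even, R4_even]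
lemma Kf_one (τ v : ℂ) : Kf τ (v + 1) = Kf τ v := by unfold Kf; simp only [R2_one, R3_one, R4_one]
lemma eC_four (a : ℂ) : eC (4 * a) = eC a ^ 4 := by
  rw [show 4 * a = 2 * (2 * a) by ring, eC_two, eC_two]; ring
lemma Kf_tau (τ v : ℂ) : Kf τ (v + τ) = eC (-4 * (τ + 2 * v)) * Kf τ v := by
  unfold Kf; simp only [R2_tau, R3_tau, R4_tau]
  rw [show -4 * (τ + 2 * v) = 4 * (-(τ + 2 * v)) by ring, eC_four]; ring
lemma Kf_T (τ v : ℂ) : Kf (τ + 1) v = Kf τ v := by unfold Kf; simp only [R2_T, R3_T, R4_T]; ring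
lemma Kf_S (v : ℂ) {τ : ℂ} (hτ : UHP τ) : Kf (-1 / τ) (v / τ) = eC (4 * (v ^ 2 / τ)) * Kf τ v := by
  unfold Kf; simp only [R2_S _ hτ, R3_S _ hτ, R4_S _ hτ, eC_four]; ring
lemma Kf_zero {τ : ℂ} (hτ : UHP τ) : Kf τ 0 = 1 := by
  unfold Kf; simp only [R2_zero hτ, R3_zero hτ, R4_zero hτ]; norm_num
lemma Kf_half (τ : ℂ) : Kf τ (1 / 2) = 0 := by
  have : R2 τ (1 / 2) = 0 := by
    unfold R2; rw [show 1 / 2 + τ / 2 = (τ + 1) / 2 by ring, th_odd_zero]; simp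
  unfold Kf; rw [this]; ring
lemma Kf_tau2 (τ : ℂ) : Kf τ (τ / 2) = 0 := by
  have : R4 τ (τ / 2) = 0 := by
    unfold R4; rw [show τ / 2 + 1 / 2 = (τ + 1) / 2 by ring, th_odd_zero]; simp
  unfold Kf; rw [this]; ring
lemma Kf_tau12 (τ : ℂ) : Kf τ ((τ + 1) / 2) = 0 := by
  have : R3 τ ((τ + 1) / 2) = 0 := by
    unfold R3; rw [th_odd_zero]; simp
  unfold Kf; rw [this]; ring

lemma th_dAt (z τ : ℂ) (hτ : UHP τ) : DifferentiableAt ℂ (fun p : ℂ × ℂ => jacobiTheta₂ p.1 p.2) (z, τ) :=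
  (hasFDerivAt_jacobiTheta₂ z hτ).differentiableAt

lemma Kf_dAt (τ v : ℂ) (hτ : UHP τ) : DifferentiableAt ℂ (fun p : ℂ × ℂ => Kf p.1 p.2) (τ, v) := by
  have key : ∀ f g : ℂ × ℂ → ℂ, DifferentiableAt ℂ f (τ, v) → DifferentiableAt ℂ g (τ, v) →
      jacobiTheta₂ (g (τ, v)) τ ≠ 0 →
      DifferentiableAt ℂ (fun p : ℂ × ℂ => (jacobiTheta₂ (f p) p.1 / jacobiTheta₂ (g p) p.1) ^ 2) (τ, v) := by
    intro f g hf hg h0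
    have a : DifferentiableAt ℂ (fun p : ℂ × ℂ => jacobiTheta₂ (f p) p.1) (τ, v) :=
       (th_dAt (f (τ, v)) τ hτ).comp (τ, v) (f := fun p : ℂ × ℂ => (f p, p.1)) (hf.prodMk (by fun_prop))
    have b : DifferentiableAt ℂ (fun p : ℂ × ℂ => jacobiTheta₂ (g p) p.1) (τ, v) :=
      (th_dAt (g (τ, v)) τ hτ).comp (τ, v) (f := fun p : ℂ × ℂ => (g p, p.1)) (hg.prodMk (by fun_prop))
    have h0' : (fun p : ℂ × ℂ => jacobiTheta₂ (g p) p.1) (τ, v) ≠ 0 := h0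
    simp only [div_eq_mul_inv]
    exact (a.mul (DifferentiableAt.inv b h0')).pow 2
  have h3 : DifferentiableAt ℂ (fun p : ℂ × ℂ => R3 p.1 p.2) (τ, v) :=
    key (fun p => p.2) (fun p => 0) (by fun_prop) (by fun_prop) (th_zero_ne hτ)
  have h4 : DifferentiableAt ℂ (fun p : ℂ × ℂ => R4 p.1 p.2) (τ, v) :=
    key (fun p => p.2 + 1 / 2) (fun p => 1 / 2) (by fun_prop) (by fun_prop) (th_half_ne hτ)
  have h2 : DifferentiableAt ℂ (fun p : ℂ × ℂ => R2 p.1 p.2) (τ, v) :=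
    ((eC_differentiable _).comp (τ, v) (by fun_prop : DifferentiableAt ℂ (fun p : ℂ × ℂ => p.2) _)).mul
    (key (fun p => p.2 + p.1 / 2) (fun p => p.1 / 2) (by fun_prop) (by fun_prop) (th_tau2_ne hτ))
  unfold Kf
  exact ((h2.mul h3).mul h4).mul (((h2.add h3).add h4).mul_const _)

lemma exists_tau {q : ℂ} (h0 : q ≠ 0) (h1 : ‖q‖ < 1) : ∃ τ, UHP τ ∧ eC (τ / 2) = q := by
  refine ⟨Complex.log q / (Real.pi * I), ?_, ?_⟩
  · unfold UHP
    have hp := Real.pi_pos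
    have : Complex.log q / (Real.pi * I) = ((1 / Real.pi : ℝ) : ℂ) * (-I * Complex.log q) := by
      rw [div_eq_iff (by simp [hp.ne'])]
      have : (Real.pi : ℂ) ≠ 0 := by simp [hp.ne']
      push_cast
      field_simp
      linear_combination (Complex.log q) * I_mul_I
    rw [this, Complex.im_ofReal_mul]
    have h2 : (-I * Complex.log q).im = - Real.log ‖q‖ := by simp [Complex.log_re]
    rw [h2]
    have := Real.log_neg (norm_pos_iff.2 h0) h1
    exact mul_pos (by positivity) (by linarith)
  · unfold eC
    have : (Real.pi : ℂ) ≠ 0 := by simp [Real.pi_pos.ne']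
    rw [show 2 * (Real.pi : ℂ) * I * (Complex.log q / (Real.pi * I) / 2) = Complex.log q by
      field_simp, Complex.exp_log h0]

lemma norm_eC_lt {τ : ℂ} (hτ : UHP τ) : ‖eC (τ / 2)‖ < 1 := by
  unfold eC UHP at *
  rw [Complex.norm_exp, Real.exp_lt_one_iff]
  have : (2 * (Real.pi : ℂ) * I * (τ / 2)).re = - (Real.pi * τ.im) := by
    rw [show 2 * (Real.pi : ℂ) * I * (τ / 2) = (Real.pi : ℂ) * (I * τ) by ring, Complex.re_ofReal_mul]; simp
  rw [this]
  have := mul_pos Real.pi_pos hτ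
  linarith

lemma recip_series (c : ℕ → ℂ) (f : ℂ → ℂ)
    (h : ∀ τ, UHP τ → HasSum (fun n : ℕ => c n * eC (τ / 2) ^ n) (f τ))
    (hf : ∀ τ, UHP τ → f τ ≠ 0) (h0 : c 0 ≠ 0) :
    ∃ d : ℕ → ℂ, ∀ τ, UHP τ → HasSum (fun n : ℕ => d n * eC (τ / 2) ^ n) (1 / f τ) := by
  set P : ℂ → ℂ := fun q => ∑' n : ℕ, c n * q ^ n with hP
  have hs : ∀ q : ℂ, q ≠ 0 → ‖q‖ < 1 → Summable (fun n : ℕ => c n * q ^ n) := by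
    intro q hq hq1
    obtain ⟨τ, hτ, rfl⟩ := exists_tau hq hq1
    exact (h τ hτ).summable
  have hPf : ∀ τ, UHP τ → P (eC (τ / 2)) = f τ := fun τ hτ => (h τ hτ).tsum_eq
  have hd : DifferentiableOn ℂ P (Metric.ball 0 1) := by
    intro q hq
    obtain ⟨r, hr1, hr2⟩ := exists_between (mem_ball_zero_iff.1 hq)
    have hr0 : 0 < r := (norm_nonneg q).trans_lt hr1
    have := differentiableOn_tsum_of_summable_norm (U := Metric.ball (0:ℂ) r) (F := fun n q => c n * q ^ n)
      (u := fun n => ‖c n * (r : ℂ) ^ n‖)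
      (hs r (by exact_mod_cast hr0.ne') (by simpa [abs_of_pos hr0] using hr2)).norm
      (fun n => by fun_prop) Metric.isOpen_ball (fun n w hw => by
        rw [norm_mul, norm_mul, norm_pow, norm_pow]
        have : ‖w‖ ≤ ‖(r : ℂ)‖ := by
          rw [mem_ball_zero_iff] at hw
          simpa [abs_of_pos hr0] using hw.le
        gcongr)
    exact (this.differentiableAt (Metric.isOpen_ball.mem_nhds (mem_ball_zero_iff.2 hr1))).differentiableWithinAt
  have hne : ∀ q ∈ Metric.ball (0:ℂ) 1, P q ≠ 0 := by
    intro q hq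
    by_cases hq0 : q = 0
    · subst hq0
      have : P 0 = c 0 := by
        simp only [hP]
        rw [tsum_eq_single 0 (fun n hn => by simp [hn])]; simp
      rw [this]; exact h0
    · obtain ⟨τ, hτ, rfl⟩ := exists_tau hq0 (mem_ball_zero_iff.1 hq)
      rw [hPf τ hτ]; exact hf τ hτ
  have hd2 : DifferentiableOn ℂ (fun q => (P q)⁻¹) (Metric.ball 0 1) := hd.inv hne
  refine ⟨fun n => ((n.factorial : ℂ))⁻¹ * iteratedDeriv n (fun q => (P q)⁻¹) 0, fun τ hτ => ?_⟩
  have := Complex.hasSum_taylorSeries_on_ball (c := 0) (r := 1) (by simpa using hd2)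
    (z := eC (τ / 2)) (by simpa using norm_eC_lt hτ)
  refine hasSum_cg this (fun n => ?_) ?_
  · simp only [smul_eq_mul, sub_zero]; ring
  · rw [hPf τ hτ, one_div]

lemma recip_series' (c : ℤ → ℂ) (e : ℤ → ℕ) (f : ℂ → ℂ)
    (h : ∀ τ, UHP τ → HasSum (fun n : ℤ => c n * eC (τ / 2) ^ e n) (f τ))
    (hf : ∀ τ, UHP τ → f τ ≠ 0) (s : Finset ℤ) (hs : ∀ n, e n = 0 ↔ n ∈ s) (h0 : ∑ n ∈ s, c n ≠ 0) :
    ∃ d : ℕ → ℂ, ∀ τ, UHP τ → HasSum (fun n : ℕ => d n * eC (τ / 2) ^ n) (1 / f τ) := by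
  refine recip_series _ f (hasSum_push e c (fun n τ => eC (τ / 2) ^ n) {τ | UHP τ} f h) hf ?_
  have : (∑' i : {i // e i = 0}, c i) = ∑ n ∈ s, c n := by
    have h1 := tsum_subtype {i | e i = 0} c
    refine h1.trans ?_
    rw [tsum_eq_sum (s := s) (fun b hb => Set.indicator_of_notMem (s := {i | e i = 0}) (fun hh => hb ((hs b).1 hh)) c)]
    exact Finset.sum_congr rfl (fun b hb => Set.indicator_of_mem (show b ∈ {i | e i = 0} from (hs b).2 hb) _)
  rw [this]; exact h0

lemma recip3 : ∃ d : ℕ → ℂ, ∀ τ, UHP τ → HasSum (fun n : ℕ => d n * eC (τ / 2) ^ n) (1 / jacobiTheta₂ 0 τ) := by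
  refine recip_series' (fun _ => 1) (fun n => n.natAbs ^ 2) _ (fun τ hτ => ?_) (fun τ hτ => th_zero_ne hτ) {0} (fun n => by simp)
    (by simp)
  refine hasSum_cg (th_hasSum 0 hτ) (fun n => ?_) rfl
  rw [← eC_nat_mul, one_mul]; congr 1
  have : ((n.natAbs ^ 2 : ℕ) : ℂ) = (n : ℂ) ^ 2 := by
    have : ((n.natAbs ^ 2 : ℕ) : ℤ) = n ^ 2 := by simp
    rw [← Int.cast_natCast, this, Int.cast_pow]
  rw [this]; ring

lemma recip4 : ∃ d : ℕ → ℂ, ∀ τ, UHP τ → HasSum (fun n : ℕ => d n * eC (τ / 2) ^ n) (1 / jacobiTheta₂ (1 / 2) τ) := by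
  refine recip_series' (fun n => eC (n / 2)) (fun n => n.natAbs ^ 2) _ (fun τ hτ => ?_) (fun τ hτ => th_half_ne hτ) {0} (fun n => by simp)
    (by simp [eC_zero])
  refine hasSum_cg (th_hasSum (1 / 2) hτ) (fun n => ?_) rfl
  rw [← eC_nat_mul, ← eC_add]; congr 1
  have : ((n.natAbs ^ 2 : ℕ) : ℂ) = (n : ℂ) ^ 2 := by
    have : ((n.natAbs ^ 2 : ℕ) : ℤ) = n ^ 2 := by simp
    rw [← Int.cast_natCast, this, Int.cast_pow]
  rw [this]; ring

lemma recip2 : ∃ d : ℕ → ℂ, ∀ τ, UHP τ → HasSum (fun n : ℕ => d n * eC (τ / 2) ^ n) (1 / jacobiTheta₂ (τ / 2) τ) := by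
  refine recip_series' (fun _ => 1) (fun n => (n ^ 2 + n).toNat) (fun τ => jacobiTheta₂ (τ / 2) τ) (fun τ hτ => ?_)
    (fun τ hτ => th_tau2_ne hτ) {0, -1} (fun n => ?_) (by simp)
  · refine hasSum_cg (th_hasSum (τ / 2) hτ) (fun n => ?_) rfl
    rw [← eC_nat_mul, one_mul]; congr 1
    have : (((n ^ 2 + n).toNat : ℕ) : ℂ) = (n : ℂ) ^ 2 + n := by
      have : (((n ^ 2 + n).toNat : ℕ) : ℤ) = n ^ 2 + n := Int.toNat_of_nonneg (by
        rcases lt_or_ge n 0 with h | h <;> nlinarith)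
      exact_mod_cast congrArg (Int.cast : ℤ → ℂ) this
    rw [this]; ring
  · rw [Int.toNat_eq_zero]
    simp only [Finset.mem_insert, Finset.mem_singleton]
    constructor
    · intro h
      have h1 : -1 ≤ n := by by_contra hh; push Not at hh; nlinarith
      have h2 : n ≤ 0 := by by_contra hh; push Not at hh; nlinarith
      omega
    · rintro (rfl | rfl) <;> norm_num

def HasExp (S : ℤ → ℤ → ℤ → Prop) (F : ℂ → ℂ → ℂ → ℂ) : Prop :=
  ∃ (ι : Type) (c : ι → ℂ) (N r s : ι → ℤ), (∀ i, S (N i) (r i) (s i)) ∧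
    ∀ τ u v, UHP τ → HasSum (fun i => c i * eC (N i * τ / 8 + r i * u + s i * v)) (F τ u v)

lemma HasExp.congr {S F G} (h : HasExp S F) (hFG : ∀ τ u v, UHP τ → G τ u v = F τ u v) : HasExp S G := by
  obtain ⟨ι, c, N, r, s, hS, h⟩ := h
  exact ⟨ι, c, N, r, s, hS, fun τ u v hτ => hasSum_cg (h τ u v hτ) (fun _ => rfl) (hFG τ u v hτ)⟩
lemma HasExp.mono {S S' : ℤ → ℤ → ℤ → Prop} {F} (h : HasExp S F) (hS' : ∀ a b c, S a b c → S' a b c) : HasExp S' F := by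
  obtain ⟨ι, c, N, r, s, hS, h⟩ := h
  exact ⟨ι, c, N, r, s, fun i => hS' _ _ _ (hS i), h⟩
lemma HasExp.mul {S1 S2 S3 : ℤ → ℤ → ℤ → Prop} {F G} (h1 : HasExp S1 F) (h2 : HasExp S2 G)
    (hS : ∀ a b c a' b' c', S1 a b c → S2 a' b' c' → S3 (a + a') (b + b') (c + c')) :
    HasExp S3 (fun τ u v => F τ u v * G τ u v) := by
  obtain ⟨ι, c, N, r, s, hS1, h1⟩ := h1
  obtain ⟨ι', c', N', r', s', hS2, h2⟩ := h2
  refine ⟨ι × ι', fun i => c i.1 * c' i.2, fun i => N i.1 + N' i.2, fun i => r i.1 + r' i.2,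
    fun i => s i.1 + s' i.2, fun i => hS _ _ _ _ _ _ (hS1 _) (hS2 _), fun τ u v hτ => ?_⟩
  refine hasSum_cg (hasSum_mul_c (h1 τ u v hτ) (h2 τ u v hτ)) (fun i => ?_) rfl
  rw [mul_mul_mul_comm, ← eC_add]; congr 2; push_cast; ring
lemma HasExp.add {S : ℤ → ℤ → ℤ → Prop} {F G} (h1 : HasExp S F) (h2 : HasExp S G) :
    HasExp S (fun τ u v => F τ u v + G τ u v) := by
  obtain ⟨ι, c, N, r, s, hS1, h1⟩ := h1
  obtain ⟨ι', c', N', r', s', hS2, h2⟩ := h2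
  refine ⟨ι ⊕ ι', Sum.elim c c', Sum.elim N N', Sum.elim r r', Sum.elim s s', ?_, fun τ u v hτ => ?_⟩
  · rintro (i | i)
    · exact hS1 i
    · exact hS2 i
  · exact HasSum.sum (hasSum_cg (h1 τ u v hτ) (fun i => rfl) rfl) (hasSum_cg (h2 τ u v hτ) (fun i => rfl) rfl)
lemma HasExp.const_mul {S : ℤ → ℤ → ℤ → Prop} {F} (a : ℂ) (h1 : HasExp S F) :
    HasExp S (fun τ u v => a * F τ u v) := by
  obtain ⟨ι, c, N, r, s, hS1, h1⟩ := h1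
  exact ⟨ι, fun i => a * c i, N, r, s, hS1, fun τ u v hτ =>
    hasSum_cg ((h1 τ u v hτ).mul_left a) (fun i => by ring) rfl⟩
lemma HasExp.shift {S S' : ℤ → ℤ → ℤ → Prop} {F} (A B C a b j : ℤ) (h1 : HasExp S F)
    (hS : ∀ x y z, S x y z → S' (x + 4 * b * (y + z) + A) (y + B) (z + C)) :
    HasExp S' (fun τ u v => eC (A * τ / 8 + B * u + C * v) *
      F (τ + j) (u + (a / 2 + b * τ / 2)) (v + (a / 2 + b * τ / 2))) := by
  obtain ⟨ι, c, N, r, s, hS1, h1⟩ := h1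
  refine ⟨ι, fun i => c i * eC (N i * j / 8 + (r i + s i) * a / 2), fun i => N i + 4 * b * (r i + s i) + A, fun i => r i + B,
    fun i => s i + C, fun i => hS _ _ _ (hS1 i), fun τ u v hτ => ?_⟩
  have hτ' : UHP (τ + j) := by simpa [UHP] using hτ
  refine hasSum_cg ((h1 _ _ _ hτ').mul_left _) (fun i => ?_) rfl
  rw [mul_left_comm, ← eC_add, mul_assoc, ← eC_add]; congr 2; push_cast; ring
lemma HasExp.swap {S : ℤ → ℤ → ℤ → Prop} {F} (h1 : HasExp S F) :
    HasExp (fun a b c => S a c b) (fun τ u v => F τ v u) := by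
  obtain ⟨ι, c, N, r, s, hS1, h1⟩ := h1
  exact ⟨ι, c, N, s, r, hS1, fun τ u v hτ =>
    hasSum_cg (h1 τ v u hτ) (fun i => by congr 2; ring) rfl⟩

lemma HasExp.recip {f : ℂ → ℂ} (h : ∃ d : ℕ → ℂ, ∀ τ, UHP τ → HasSum (fun n : ℕ => d n * eC (τ / 2) ^ n) (1 / f τ)) :
    HasExp (fun N r s => 0 ≤ N ∧ r = 0 ∧ s = 0) (fun τ _ _ => 1 / f τ) := by
  obtain ⟨d, h⟩ := h
  refine ⟨ℕ, d, fun n => 4 * n, fun _ => 0, fun _ => 0, fun n => ⟨by positivity, rfl, rfl⟩, fun τ u v hτ => ?_⟩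
  refine hasSum_cg (h τ hτ) (fun n => ?_) rfl
  rw [← eC_nat_mul]; congr 2; push_cast; ring

lemma th_exp : HasExp (fun N r s => r = 0 ∧ N = 4 * s ^ 2) (fun τ _ v => jacobiTheta₂ v τ) := by
  refine ⟨ℤ, fun _ => 1, fun n => 4 * n ^ 2, fun _ => 0, fun n => n, fun n => ⟨rfl, rfl⟩, fun τ u v hτ => ?_⟩
  refine hasSum_cg (th_hasSum v hτ) (fun n => ?_) rfl
  rw [one_mul]; congr 1; push_cast; ring

lemma ratio_exp {S : ℤ → ℤ → ℤ → Prop} {F : ℂ → ℂ → ℂ → ℂ} {f : ℂ → ℂ} (h1 : HasExp S F)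
    (h : ∃ d : ℕ → ℂ, ∀ τ, UHP τ → HasSum (fun n : ℕ => d n * eC (τ / 2) ^ n) (1 / f τ))
    (hS : ∀ a b c d, S a b c → 0 ≤ d → S (a + d) b c) :
    HasExp S (fun τ u v => F τ u v / f τ) := by
  refine (h1.mul (S3 := S) (HasExp.recip h) ?_).congr (fun τ u v hτ => by ring)
  rintro a b c a' b' c' h ⟨h1, rfl, rfl⟩
  simpa using hS a b c a' h h1

lemma R3_exp : HasExp (fun N r s => r = 0 ∧ 2 * s ^ 2 ≤ N) (fun τ _ v => R3 τ v) := by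
  have h1 := ratio_exp (th_exp.mono (S' := fun N r s => r = 0 ∧ 4 * s ^ 2 ≤ N) (fun a b c h => ⟨h.1, h.2.ge⟩)) recip3
    (fun a b c d h hd => ⟨h.1, by linarith [h.2]⟩)
  refine (h1.mul h1 (S3 := fun N r s => r = 0 ∧ 2 * s ^ 2 ≤ N) ?_).congr (fun τ u v hτ => by simp only [R3]; ring)
  rintro a b c a' b' c' ⟨rfl, h⟩ ⟨rfl, h'⟩
  exact ⟨rfl, by nlinarith [sq_nonneg (c - c')]⟩

lemma R4_exp : HasExp (fun N r s => r = 0 ∧ 2 * s ^ 2 ≤ N) (fun τ _ v => R4 τ v) := by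
  have h0 : HasExp (fun N r s => r = 0 ∧ 4 * s ^ 2 ≤ N) (fun τ _ v => jacobiTheta₂ (v + 1 / 2) τ) := by
    refine (th_exp.shift 0 0 0 1 0 0 (S' := fun N r s => r = 0 ∧ 4 * s ^ 2 ≤ N) ?_).congr (fun τ u v hτ => ?_)
    · rintro a b c ⟨rfl, rfl⟩; simp
    · simp [eC_zero]
  have h1 := ratio_exp h0 recip4 (fun a b c d h hd => ⟨h.1, by linarith [h.2]⟩)
  refine (h1.mul h1 (S3 := fun N r s => r = 0 ∧ 2 * s ^ 2 ≤ N) ?_).congr (fun τ u v hτ => by simp only [R4]; ring)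
  rintro a b c a' b' c' ⟨rfl, h⟩ ⟨rfl, h'⟩
  exact ⟨rfl, by nlinarith [sq_nonneg (c - c')]⟩

lemma R2_exp : HasExp (fun N r s => r = 0 ∧ 2 * s ^ 2 - 2 ≤ N) (fun τ _ v => R2 τ v) := by
  have h0 : HasExp (fun N r s => r = 0 ∧ 4 * s ^ 2 + 4 * s ≤ N) (fun τ _ v => jacobiTheta₂ (v + τ / 2) τ) := by
    refine (th_exp.shift 0 0 0 0 1 0 (S' := fun N r s => r = 0 ∧ 4 * s ^ 2 + 4 * s ≤ N) ?_).congr (fun τ u v hτ => ?_)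
    · rintro a b c ⟨rfl, rfl⟩; simp
    · simp [eC_zero]
  have h00 : HasExp (fun N r s => r = 0 ∧ 4 * (s - 1) ^ 2 + 4 * (s - 1) ≤ N) (fun τ _ v => eC v * jacobiTheta₂ (v + τ / 2) τ) := by
    refine (h0.shift 0 0 1 0 0 0 (S' := fun N r s => r = 0 ∧ 4 * (s - 1) ^ 2 + 4 * (s - 1) ≤ N) ?_).congr (fun τ u v hτ => ?_)
    · rintro a b c ⟨rfl, h⟩; simpa using h
    · simp
  have h1 := ratio_exp h0 recip2 (fun a b c d h hd => ⟨h.1, by linarith [h.2]⟩)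
  have h2 := ratio_exp h00 recip2 (fun a b c d h hd => ⟨h.1, by linarith [h.2]⟩)
  refine (h1.mul h2 (S3 := fun N r s => r = 0 ∧ 2 * s ^ 2 - 2 ≤ N) ?_).congr (fun τ u v hτ => by simp only [R2]; ring)
  rintro a b c a' b' c' ⟨rfl, h⟩ ⟨rfl, h'⟩
  exact ⟨rfl, by nlinarith [sq_nonneg (c - c' + 1)]⟩

lemma K_exp : HasExp (fun N r s => r = 0 ∧ s ^ 2 - 8 ≤ 2 * N) (fun τ _ v => Kf τ v) := by
  have h23 := R2_exp.mul R3_exp (S3 := fun N r s => r = 0 ∧ s ^ 2 - 2 ≤ N) (by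
    rintro a b c a' b' c' ⟨rfl, h⟩ ⟨rfl, h'⟩
    exact ⟨rfl, by nlinarith [sq_nonneg (c - c')]⟩)
  have hsum := ((R2_exp.add (R3_exp.mono (fun a b c h => ⟨h.1, by linarith [h.2]⟩))).add
    (R4_exp.mono (fun a b c h => ⟨h.1, by linarith [h.2]⟩))).const_mul (1 / 3)
  have h4 := R4_exp.mul hsum (S3 := fun N r s => r = 0 ∧ s ^ 2 - 2 ≤ N) (by
    rintro a b c a' b' c' ⟨rfl, h⟩ ⟨rfl, h'⟩
    exact ⟨rfl, by nlinarith [sq_nonneg (c - c')]⟩)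
  refine (h23.mul h4 (S3 := fun N r s => r = 0 ∧ s ^ 2 - 8 ≤ 2 * N) ?_).congr (fun τ u v hτ => by simp only [Kf]; ring)
  rintro a b c a' b' c' ⟨rfl, h⟩ ⟨rfl, h'⟩
  exact ⟨rfl, by nlinarith [sq_nonneg (c - c')]⟩

lemma JF_odd (k : ℕ) (hk4 : k % 4 = 1) (ψ : ℂ → ℂ → ℂ) (h : IsJF k 4 ψ) (τ z : ℂ) (hτ : UHP τ) :
    ψ τ (-z) = - ψ τ z := by
  have := h.transf (-1) τ z hτ
  have hk : (-1 : ℂ) ^ k = -1 := Odd.neg_one_pow (Nat.odd_iff.2 (by omega))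
  simpa [Ma, Mb, Mc, Md, eC_zero, hk, div_neg] using this
lemma JF_T (k : ℕ) (ψ : ℂ → ℂ → ℂ) (h : IsJF k 4 ψ) (τ z : ℂ) (hτ : UHP τ) :
    ψ (τ + 1) z = ψ τ z := by
  have := h.transf ModularGroup.T τ z hτ
  simpa [Ma, Mb, Mc, Md, eC_zero, ModularGroup.T] using this
lemma JF_S (k : ℕ) (ψ : ℂ → ℂ → ℂ) (h : IsJF k 4 ψ) (τ z : ℂ) (hτ : UHP τ) :
    ψ (-1 / τ) (z / τ) = τ ^ k * eC (4 * (z ^ 2 / τ)) * ψ τ z := by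
  have := h.transf ModularGroup.S τ z hτ
  simpa [Ma, Mb, Mc, Md, eC_zero, ModularGroup.S, mul_div_assoc] using this
lemma JF_one (k : ℕ) (ψ : ℂ → ℂ → ℂ) (h : IsJF k 4 ψ) (τ z : ℂ) (hτ : UHP τ) :
    ψ τ (z + 1) = ψ τ z := by
  have := h.ellip 0 1 τ z hτ
  simpa [eC_zero] using this
lemma JF_tau (k : ℕ) (ψ : ℂ → ℂ → ℂ) (h : IsJF k 4 ψ) (τ z : ℂ) (hτ : UHP τ) :
    ψ τ (z + τ) = eC (-4 * (τ + 2 * z)) * ψ τ z := by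
  have := h.ellip 1 0 τ z hτ
  simpa [eC_zero] using this

lemma hasSum_restrict {ι : Type} {f : ι → ℂ} {a : ℂ} (h : HasSum f a) (S : Set ι) (hS : ∀ i, i ∉ S → f i = 0) :
    HasSum (fun i : S => f i) a :=
  (hasSum_subtype_iff_of_support_subset (fun i hi => by
    by_contra hh; exact hi (hS i hh))).2 h

lemma psi_exp (k : ℕ) (hk4 : k % 4 = 1) (ψ : ℂ → ℂ → ℂ) (h : IsJF k 4 ψ) :
    HasExp (fun N r s => s = 0 ∧ r ^ 2 + 7 ≤ 2 * N) (fun τ u _ => ψ τ u) := by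
  obtain ⟨c, hc0, hc⟩ := h.fourier
  have key : ∀ τ u, UHP τ → HasSum (fun p : ℕ × ℤ => (if (4:ℤ) ∣ p.2 then 0 else c p.1 p.2) * eC (p.1 * τ + p.2 * u)) (ψ τ u) := by
    intro τ u hτ
    have h1 := hasSum_push (ι := ℕ × ℤ) (fun p => p.2) (fun p => c p.1 p.2 * eC (p.1 * τ)) (fun r (x : ℂ) => eC (r * x)) Set.univ
      (ψ τ) (fun x _ => hasSum_cg (hc τ x hτ) (fun p => by rw [eC_add]; ring) rfl)
    have h2 := odd_index_four _ (ψ τ) τ (fun x => h1 x trivial) (fun x => JF_tau k ψ h τ x hτ)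
      (fun x => JF_odd k hk4 ψ h τ x hτ)
    set g : ℕ × ℤ → ℂ := fun p => if (4:ℤ) ∣ p.2 then c p.1 p.2 * eC (p.1 * τ) else 0 with hg
    have hsum : Summable (fun p : ℕ × ℤ => g p * eC (p.2 * u)) := by
      refine ((hc τ u hτ).summable.indicator {p : ℕ × ℤ | (4:ℤ) ∣ p.2}).congr (fun p => ?_)
      simp only [hg, Set.indicator_apply, Set.mem_ofPred_eq]
      split_ifs
      · rw [eC_add]; ring
      · simp
    have h3 := hasSum_push (ι := ℕ × ℤ) (P := Unit) (fun p => p.2) g (fun r _ => eC (r * u)) Set.univ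
      (fun _ => ∑' p : ℕ × ℤ, g p * eC (p.2 * u)) (fun x _ => hsum.hasSum) () trivial
    have h4 : ∀ r : ℤ, (∑' i : {i : ℕ × ℤ // i.2 = r}, g i) = 0 := by
      intro r
      by_cases hr : (4:ℤ) ∣ r
      · obtain ⟨s, rfl⟩ := hr
        rw [← h2 s]
        refine tsum_congr (fun i => ?_)
        simp only [hg]
        rw [if_pos (by rw [i.2]; exact dvd_mul_right _ _)]
      · have : ∀ i : {i : ℕ × ℤ // i.2 = r}, g i = 0 := by
          intro i; simp only [hg]
          rw [if_neg (by rw [i.2]; exact hr)]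
        simp [this]
    simp only [h4, zero_mul] at h3
    have h5 : ∑' p : ℕ × ℤ, g p * eC (p.2 * u) = 0 := h3.unique hasSum_zero
    have h6 := (hc τ u hτ).sub hsum.hasSum
    rw [h5, sub_zero] at h6
    refine hasSum_cg h6 (fun p => ?_) rfl
    simp only [hg]
    split_ifs
    · rw [eC_add]; ring
    · ring
  refine ⟨{p : ℕ × ℤ | p.2 ^ 2 ≤ 16 * p.1 ∧ ¬ (4:ℤ) ∣ p.2}, fun p => c p.1.1 p.1.2, fun p => 8 * p.1.1, fun p => p.1.2, fun _ => 0, ?_, ?_⟩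
  · rintro ⟨⟨n, r⟩, h1, h2⟩
    refine ⟨rfl, ?_⟩
    simp only at h1 h2 ⊢
    have : r % 4 = 1 ∨ r % 4 = 2 ∨ r % 4 = 3 := by omega
    obtain ⟨q, hq⟩ : ∃ q, q = r / 4 := ⟨_, rfl⟩
    rcases this with hh | hh | hh
    · obtain rfl : r = 4 * q + 1 := by omega
      ring_nf at h1 ⊢
      have : ∃ t, t = q ^ 2 := ⟨_, rfl⟩
      obtain ⟨t, ht⟩ := this
      rw [← ht] at h1 ⊢
      omega
    · obtain rfl : r = 4 * q + 2 := by omega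
      ring_nf at h1 ⊢
      have : ∃ t, t = q ^ 2 := ⟨_, rfl⟩
      obtain ⟨t, ht⟩ := this
      rw [← ht] at h1 ⊢
      omega
    · obtain rfl : r = 4 * q + 3 := by omega
      ring_nf at h1 ⊢
      have : ∃ t, t = q ^ 2 := ⟨_, rfl⟩
      obtain ⟨t, ht⟩ := this
      rw [← ht] at h1 ⊢
      omega
  · intro τ u v hτ
    refine hasSum_cg (hasSum_restrict (key τ u hτ) {p : ℕ × ℤ | p.2 ^ 2 ≤ 16 * p.1 ∧ ¬ (4:ℤ) ∣ p.2} ?_) ?_ rfl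
    · intro p hp
      simp only [Set.mem_ofPred_eq, not_and, not_not] at hp
      split_ifs with h4
      · simp
      · rw [hc0 _ _ (by push_cast; by_contra hh; exact h4 (hp (by linarith)))]; simp
    · rintro ⟨⟨n, r⟩, h1, h2⟩
      simp only at h2 ⊢
      rw [if_neg h2]; congr 2; push_cast; ring

lemma HasExp.avgT {S : ℤ → ℤ → ℤ → Prop} {F} (h : HasExp S F) (hF : ∀ τ u v, UHP τ → F (τ + 1) u v = F τ u v) :
    HasExp (fun N r s => S N r s ∧ 8 ∣ N) F := by
  obtain ⟨ι, c, N, r, s, hS, h⟩ := h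
  have hF' : ∀ (j : ℕ) τ u v, UHP τ → F (τ + j) u v = F τ u v := by
    intro j
    induction j with
    | zero => intro τ u v _; simp
    | succ n ih =>
      intro τ u v hτ
      rw [show τ + ((n + 1 : ℕ) : ℂ) = τ + 1 + n by push_cast; ring, ih _ _ _ hτ.add_one, hF _ _ _ hτ]
  have key : ∀ τ u v, UHP τ → HasSum (fun i => (c i * (∑ j ∈ Finset.range 8, eC (N i / 8) ^ j) / 8) * eC (N i * τ / 8 + r i * u + s i * v)) (F τ u v) := by
    intro τ u v hτ
    have h1 := hasSum_sum (s := Finset.range 8) (fun (j : ℕ) _ => h (τ + j) u v (by simpa [UHP] using hτ))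
    refine hasSum_cg (h1.mul_left (1 / 8)) (fun i => ?_) ?_
    · rw [Finset.mul_sum, Finset.sum_div, Finset.sum_mul, Finset.mul_sum]
      refine Finset.sum_congr rfl (fun j _ => ?_)
      rw [← eC_nat_mul, show N i * (τ + j) / 8 + r i * u + s i * v = j * (N i / 8) + (N i * τ / 8 + r i * u + s i * v) by ring,
        eC_add (j * (N i / 8))]
      ring
    · rw [Finset.sum_congr rfl (fun j _ => hF' j τ u v hτ)]; simp
  refine ⟨{i | 8 ∣ N i}, fun i => c i * (∑ j ∈ Finset.range 8, eC (N i / 8) ^ j) / 8, fun i => N i, fun i => r i, fun i => s i,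
    fun i => ⟨hS i, i.2⟩, fun τ u v hτ => hasSum_restrict (key τ u v hτ) _ (fun i hi => ?_)⟩
  have hne : eC (N i / 8) ≠ 1 := by
    intro he
    unfold eC at he
    rw [Complex.exp_eq_one_iff] at he
    obtain ⟨n, hn⟩ := he
    apply hi
    refine ⟨n, ?_⟩
    have : (N i : ℂ) = 8 * n := by
      have h2 := Complex.two_pi_I_ne_zero
      have h3 : (2 * Real.pi * I) * ((N i : ℂ) / 8 - n) = 0 := by linear_combination hn
      have := (mul_eq_zero.1 h3).resolve_left h2
      linear_combination 8 * this
    exact_mod_cast this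
  have hp : eC (N i / 8) ^ 8 = 1 := by
    rw [← eC_nat_mul, ← eC_int (N i)]; congr 1; push_cast; ring
  rw [geom_sum_eq hne, hp]; simp

lemma HasExp.avgH {S : ℤ → ℤ → ℤ → Prop} {F} (h : HasExp S F)
    (hF : ∀ τ u v, UHP τ → F τ (u + 1 / 2) (v + 1 / 2) = F τ u v) :
    HasExp (fun N r s => S N r s ∧ 2 ∣ r + s) F := by
  obtain ⟨ι, c, N, r, s, hS, h⟩ := h
  have key : ∀ τ u v, UHP τ → HasSum (fun i => (c i * (1 + eC ((r i + s i) / 2)) / 2) * eC (N i * τ / 8 + r i * u + s i * v)) (F τ u v) := by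
    intro τ u v hτ
    have h1 := (h τ u v hτ).add (h τ (u + 1 / 2) (v + 1 / 2) hτ)
    refine hasSum_cg (h1.mul_left (1 / 2)) (fun i => ?_) ?_
    · rw [show N i * τ / 8 + r i * (u + 1 / 2) + s i * (v + 1 / 2) = (r i + s i) / 2 + (N i * τ / 8 + r i * u + s i * v) by ring,
        eC_add ((r i + s i) / 2)]
      ring
    · rw [hF _ _ _ hτ]; ring
  refine ⟨{i | 2 ∣ r i + s i}, fun i => c i * (1 + eC ((r i + s i) / 2)) / 2, fun i => N i, fun i => r i, fun i => s i,
    fun i => ⟨hS i, i.2⟩, fun τ u v hτ => hasSum_restrict (key τ u v hτ) _ (fun i hi => ?_)⟩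
  obtain ⟨m, hm⟩ : ∃ m, r i + s i = 2 * m + 1 := by
    refine ⟨(r i + s i) / 2, ?_⟩
    have : ¬ 2 ∣ r i + s i := hi
    omega
  have hm' : (r i : ℂ) + s i = 2 * m + 1 := by exact_mod_cast hm
  rw [hm', show (2 * (m : ℂ) + 1) / 2 = 1 / 2 + m by ring, eC_add_int, eC_half]; simp

structure QJ (k : ℕ) (σ : ℂ) (f : ℂ → ℂ → ℂ) : Prop where
  par : ∀ τ z, UHP τ → f τ (-z) = σ * f τ z
  one : ∀ τ z, UHP τ → f τ (z + 1) = f τ z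
  tau : ∀ τ z, UHP τ → f τ (z + τ) = eC (-4 * (τ + 2 * z)) * f τ z
  T : ∀ τ z, UHP τ → f (τ + 1) z = f τ z
  S : ∀ τ z, UHP τ → f (-1 / τ) (z / τ) = τ ^ k * eC (4 * (z ^ 2 / τ)) * f τ z

lemma QJ_psi (k : ℕ) (hk4 : k % 4 = 1) (ψ : ℂ → ℂ → ℂ) (h : IsJF k 4 ψ) : QJ k (-1) ψ :=
  ⟨fun τ z hτ => by rw [JF_odd k hk4 ψ h τ z hτ]; ring, JF_one k ψ h, JF_tau k ψ h, JF_T k ψ h, JF_S k ψ h⟩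
lemma QJ_K : QJ 0 1 Kf :=
  ⟨fun τ z _ => by rw [Kf_even, one_mul], fun τ z _ => Kf_one τ z, fun τ z _ => Kf_tau τ z, fun τ z _ => Kf_T τ z,
    fun τ z hτ => by rw [Kf_S z hτ, pow_zero, one_mul]⟩

lemma QJ.half {k σ f} (h : QJ k σ f) (τ u : ℂ) (hτ : UHP τ) : f τ (-u + 1 / 2) = σ * f τ (u + 1 / 2) := by
  rw [show -u + 1 / 2 = -(u - 1 / 2) by ring, h.par _ _ hτ, ← h.one _ _ hτ]; congr 2; ring
lemma QJ.half2 {k σ f} (h : QJ k σ f) (τ u : ℂ) (hτ : UHP τ) : f τ (-u + τ / 2) = σ * eC (8 * u) * f τ (u + τ / 2) := by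
  rw [show -u + τ / 2 = -(u - τ / 2) by ring, h.par _ _ hτ, show u + τ / 2 = u - τ / 2 + τ by ring, h.tau _ _ hτ, mul_assoc,
    ← mul_assoc (eC _), ← eC_add, show 8 * u + -4 * (τ + 2 * (u - τ / 2)) = 0 by ring, eC_zero, one_mul]
lemma QJ.half3 {k σ f} (h : QJ k σ f) (τ u : ℂ) (hτ : UHP τ) :
    f τ (-u + (τ + 1) / 2) = σ * eC (8 * u) * f τ (u + (τ + 1) / 2) := by
  rw [show -u + (τ + 1) / 2 = -(u - τ / 2 + 1 / 2 ) + 1 by ring, h.one _ _ hτ, h.par _ _ hτ,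
    show u + (τ + 1) / 2 = u - τ / 2 + 1 / 2 + τ by ring, h.tau _ _ hτ, mul_assoc,
    ← mul_assoc (eC _), ← eC_add, show 8 * u + -4 * (τ + 2 * (u - τ / 2 + 1 / 2)) = ((-4 : ℤ) : ℂ) by push_cast; ring, eC_int, one_mul]

def Af (f g : ℂ → ℂ → ℂ) (τ u v : ℂ) : ℂ :=
  f τ u * g τ v + f τ (u + 1 / 2) * g τ (v + 1 / 2)
    + eC (2 * τ + 4 * u + 4 * v) * (f τ (u + τ / 2) * g τ (v + τ / 2) + f τ (u + (τ + 1) / 2) * g τ (v + (τ + 1) / 2))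

lemma Af_symm (f g : ℂ → ℂ → ℂ) (τ u v : ℂ) : Af f g τ u v = Af g f τ v u := by
  simp only [Af]
  rw [show 2 * τ + 4 * u + 4 * v = 2 * τ + 4 * v + 4 * u by ring]; ring


lemma Af_negu {k σ f g} (hf : QJ k σ f) (τ u v : ℂ) (hτ : UHP τ) : Af f g τ (-u) v = σ * Af f g τ u v := by
  simp only [Af]
  rw [hf.par _ _ hτ, hf.half _ _ hτ, hf.half2 _ _ hτ, hf.half3 _ _ hτ,
    show 2 * τ + 4 * u + 4 * v = (2 * τ + 4 * -u + 4 * v) + 8 * u by ring, eC_add _ (8 * u)]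
  ring

lemma Af_half {k σ σ' f g} (hf : QJ k σ f) (hg : QJ 0 σ' g) (τ u v : ℂ) (hτ : UHP τ) : Af f g τ (u + 1 / 2) (v + 1 / 2) = Af f g τ u v := by
  simp only [Af]
  rw [show u + 1 / 2 + 1 / 2 = u + 1 by ring, show v + 1 / 2 + 1 / 2 = v + 1 by ring,
    show u + 1 / 2 + τ / 2 = u + (τ + 1) / 2 by ring, show v + 1 / 2 + τ / 2 = v + (τ + 1) / 2 by ring,
    show u + 1 / 2 + (τ + 1) / 2 = u + τ / 2 + 1 by ring, show v + 1 / 2 + (τ + 1) / 2 = v + τ / 2 + 1 by ring,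
    hf.one _ _ hτ, hf.one _ _ hτ, hg.one _ _ hτ, hg.one _ _ hτ,
    show 2 * τ + 4 * (u + 1 / 2) + 4 * (v + 1 / 2) = 2 * τ + 4 * u + 4 * v + ((4 : ℤ) : ℂ) by push_cast; ring, eC_add_int]
  ring

lemma Af_tau {k σ σ' f g} (hf : QJ k σ f) (hg : QJ 0 σ' g) (τ u v : ℂ) (hτ : UHP τ) :
    Af f g τ (u + τ / 2) (v + τ / 2) = eC (-(2 * τ + 4 * u + 4 * v)) * Af f g τ u v := by
  simp only [Af]
  rw [show u + τ / 2 + τ / 2 = u + τ by ring, show v + τ / 2 + τ / 2 = v + τ by ring,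
    show u + τ / 2 + 1 / 2 = u + (τ + 1) / 2 by ring, show v + τ / 2 + 1 / 2 = v + (τ + 1) / 2 by ring,
    show u + τ / 2 + (τ + 1) / 2 = u + 1 / 2 + τ by ring, show v + τ / 2 + (τ + 1) / 2 = v + 1 / 2 + τ by ring,
    hf.tau _ _ hτ, hf.tau _ _ hτ, hg.tau _ _ hτ, hg.tau _ _ hτ,
    show -4 * (τ + 2 * (u + 1 / 2)) = -4 * (τ + 2 * u) + ((-4 : ℤ) : ℂ) by push_cast; ring, eC_add_int,
    show -4 * (τ + 2 * (v + 1 / 2)) = -4 * (τ + 2 * v) + ((-4 : ℤ) : ℂ) by push_cast; ring, eC_add_int]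
  have h1 : eC (2 * τ + 4 * (u + τ / 2) + 4 * (v + τ / 2)) * eC (-4 * (τ + 2 * u)) * eC (-4 * (τ + 2 * v))
    = eC (-(2 * τ + 4 * u + 4 * v)) := by
    rw [← eC_add, ← eC_add]; congr 1; ring
  have h2 : eC (-(2 * τ + 4 * u + 4 * v)) * eC (2 * τ + 4 * u + 4 * v) = 1 := by
    rw [← eC_add, neg_add_cancel, eC_zero]
  linear_combination (f τ u * g τ v + f τ (u + 1 / 2) * g τ (v + 1 / 2)) * h1
    - (f τ (u + τ / 2) * g τ (v + τ / 2) + f τ (u + (τ + 1) / 2) * g τ (v + (τ + 1) / 2)) * h2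

lemma Af_T {k σ σ' f g} (hf : QJ k σ f) (hg : QJ 0 σ' g) (τ u v : ℂ) (hτ : UHP τ) : Af f g (τ + 1) u v = Af f g τ u v := by
  simp only [Af]
  rw [hf.T _ _ hτ, hf.T _ _ hτ, hf.T _ _ hτ, hf.T _ _ hτ, hg.T _ _ hτ, hg.T _ _ hτ, hg.T _ _ hτ, hg.T _ _ hτ,
    show u + (τ + 1 + 1) / 2 = u + τ / 2 + 1 by ring, show v + (τ + 1 + 1) / 2 = v + τ / 2 + 1 by ring,
    hf.one _ _ hτ, hg.one _ _ hτ,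
    show 2 * (τ + 1) + 4 * u + 4 * v = 2 * τ + 4 * u + 4 * v + ((2 : ℤ) : ℂ) by push_cast; ring, eC_add_int]
  ring

lemma Af_S {k σ σ' f g} (hf : QJ k σ f) (hg : QJ 0 σ' g) (τ u v : ℂ) (hτ : UHP τ) :
    Af f g (-1 / τ) (u / τ) (v / τ) = τ ^ k * eC (4 * ((u ^ 2 + v ^ 2) / τ)) * Af f g τ u v := by
  have h0 := hτ.ne
  have m : ∀ a b, f (-1 / τ) (a / τ) * g (-1 / τ) (b / τ) = τ ^ k * eC (4 * ((a ^ 2 + b ^ 2) / τ)) * (f τ a * g τ b) := by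
    intro a b
    rw [hf.S _ _ hτ, hg.S _ _ hτ, show 4 * ((a ^ 2 + b ^ 2) / τ) = 4 * (a ^ 2 / τ) + 4 * (b ^ 2 / τ) by ring, eC_add]; ring
  have s : ∀ w, w / τ + 1 / 2 = (w + τ / 2) / τ := by intro w; field_simp
  have s2 : ∀ w, w / τ + (-1 / τ) / 2 = (w - 1 / 2) / τ := by intro w; field_simp; ring
  have s3 : ∀ w, w / τ + (-1 / τ + 1) / 2 = (w - 1 / 2 + τ / 2) / τ := by intro w; field_simp; ring
  simp only [Af, s, s2, s3, m]
  have o : ∀ w, f τ (w - 1 / 2) = f τ (w + 1 / 2) := fun w => by rw [← hf.one _ _ hτ]; congr 1; ring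
  have o' : ∀ w, g τ (w - 1 / 2) = g τ (w + 1 / 2) := fun w => by rw [← hg.one _ _ hτ]; congr 1; ring
  have o2 : ∀ w, f τ (w - 1 / 2 + τ / 2) = f τ (w + (τ + 1) / 2) := fun w => by rw [← hf.one _ _ hτ]; congr 1; ring
  have o2' : ∀ w, g τ (w - 1 / 2 + τ / 2) = g τ (w + (τ + 1) / 2) := fun w => by rw [← hg.one _ _ hτ]; congr 1; ring
  simp only [o, o', o2, o2']
  have e1 : eC (4 * (((u + τ / 2) ^ 2 + (v + τ / 2) ^ 2) / τ)) = eC (4 * ((u ^ 2 + v ^ 2) / τ)) * eC (2 * τ + 4 * u + 4 * v) := by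
    rw [← eC_add]; congr 1; field_simp; ring
  have e2 : eC (2 * (-1 / τ) + 4 * (u / τ) + 4 * (v / τ)) * eC (4 * (((u - 1 / 2) ^ 2 + (v - 1 / 2) ^ 2) / τ)) = eC (4 * ((u ^ 2 + v ^ 2) / τ)) := by
    rw [← eC_add]; congr 1; field_simp; ring
  have e3 : eC (2 * (-1 / τ) + 4 * (u / τ) + 4 * (v / τ)) * eC (4 * (((u - 1 / 2 + τ / 2) ^ 2 + (v - 1 / 2 + τ / 2) ^ 2) / τ))
      = eC (4 * ((u ^ 2 + v ^ 2) / τ)) * eC (2 * τ + 4 * u + 4 * v) := by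
    rw [← eC_add, ← eC_add, ← eC_add_int (4 * ((u ^ 2 + v ^ 2) / τ) + _) (-4)]; congr 1; push_cast; field_simp; ring
  rw [e1]
  linear_combination (τ ^ k * (f τ (u + 1 / 2) * g τ (v + 1 / 2))) * e2 + (τ ^ k * (f τ (u + (τ + 1) / 2) * g τ (v + (τ + 1) / 2))) * e3

def Pf (ψ : ℂ → ℂ → ℂ) (τ u v : ℂ) : ℂ := Af ψ Kf τ u v - I * Af ψ Kf τ v u

lemma Pf_half {k ψ} (hf : QJ k (-1) ψ) (τ u v : ℂ) (hτ : UHP τ) : Pf ψ τ (u + 1 / 2) (v + 1 / 2) = Pf ψ τ u v := by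
  simp only [Pf, Af_half hf QJ_K _ _ _ hτ]
lemma Pf_tau {k ψ} (hf : QJ k (-1) ψ) (τ u v : ℂ) (hτ : UHP τ) : Pf ψ τ (u + τ / 2) (v + τ / 2) = eC (-(2 * τ + 4 * u + 4 * v)) * Pf ψ τ u v := by
  simp only [Pf, Af_tau hf QJ_K _ _ _ hτ]
  rw [show 2 * τ + 4 * v + 4 * u = 2 * τ + 4 * u + 4 * v by ring]; ring
lemma Pf_T {k ψ} (hf : QJ k (-1) ψ) (τ u v : ℂ) (hτ : UHP τ) : Pf ψ (τ + 1) u v = Pf ψ τ u v := by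
  simp only [Pf, Af_T hf QJ_K _ _ _ hτ]
lemma Pf_S {k ψ} (hf : QJ k (-1) ψ) (τ u v : ℂ) (hτ : UHP τ) : Pf ψ (-1 / τ) (u / τ) (v / τ) = τ ^ k * eC (4 * ((u ^ 2 + v ^ 2) / τ)) * Pf ψ τ u v := by
  simp only [Pf, Af_S hf QJ_K _ _ _ hτ]
  rw [show v ^ 2 + u ^ 2 = u ^ 2 + v ^ 2 by ring]; ring
lemma Pf_rot {k ψ} (hf : QJ k (-1) ψ) (τ u v : ℂ) (hτ : UHP τ) : Pf ψ τ v (-u) = I * Pf ψ τ u v := by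
  have : ∀ a b, Af ψ Kf τ a (-b) = Af ψ Kf τ a b := by
    intro a b
    rw [Af_symm, Af_negu QJ_K _ _ _ hτ, one_mul, Af_symm]
  simp only [Pf, this, Af_negu hf _ _ _ hτ]
  linear_combination (Af ψ Kf τ v u) * I_mul_I
lemma Pf_res {k ψ} (hf : QJ k (-1) ψ) (τ z : ℂ) (hτ : UHP τ) : Pf ψ τ z 0 = ψ τ z := by
  have h1 := Af_negu (g := Kf) hf τ 0 z hτ
  rw [neg_zero] at h1
  have h2 : Af ψ Kf τ 0 z = 0 := by linear_combination h1 / 2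
  simp only [Pf, h2]
  simp only [Af, zero_add, Kf_zero hτ, Kf_half, Kf_tau2, Kf_tau12]
  ring

def Hf (ψ : ℂ → ℂ → ℂ) (τ z₁ z₂ : ℂ) : ℂ :=
  Pf ψ τ (((1 - I) * z₁ + (1 + I) * z₂) / 4) (((1 + I) * z₁ + (1 - I) * z₂) / 4)

lemma Hf_one {k ψ} (hf : QJ k (-1) ψ) (τ z₁ z₂ : ℂ) (hτ : UHP τ) : Hf ψ τ (z₁ + 1) (z₂ + 1) = Hf ψ τ z₁ z₂ := by
  simp only [Hf]
  rw [← Pf_half hf τ (((1 - I) * z₁ + (1 + I) * z₂) / 4) _ hτ]; congr 1 <;> ring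
lemma Hf_tau {k ψ} (hf : QJ k (-1) ψ) (τ z₁ z₂ : ℂ) (hτ : UHP τ) :
    Hf ψ τ (z₁ + τ) (z₂ + τ) = eC (-2 * (τ + z₁ + z₂)) * Hf ψ τ z₁ z₂ := by
  simp only [Hf]
  rw [show -2 * (τ + z₁ + z₂) = -(2 * τ + 4 * (((1 - I) * z₁ + (1 + I) * z₂) / 4) + 4 * (((1 + I) * z₁ + (1 - I) * z₂) / 4)) by ring,
    ← Pf_tau hf _ _ _ hτ]; congr 1 <;> ring
lemma Hf_rot {k ψ} (hf : QJ k (-1) ψ) (τ z₁ z₂ : ℂ) (hτ : UHP τ) :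
    Hf ψ τ (I * z₁) (-I * z₂) = I * Hf ψ τ z₁ z₂ := by
  simp only [Hf]
  rw [← Pf_rot hf _ _ _ hτ]; congr 1
  · linear_combination (-z₁ / 4 - z₂ / 4) * I_mul_I
  · linear_combination (z₁ / 4 + z₂ / 4) * I_mul_I
lemma Hf_T {k ψ} (hf : QJ k (-1) ψ) (τ z₁ z₂ : ℂ) (hτ : UHP τ) : Hf ψ (τ + 1) z₁ z₂ = Hf ψ τ z₁ z₂ := by
  simp only [Hf, Pf_T hf _ _ _ hτ]
lemma Hf_S {k ψ} (hf : QJ k (-1) ψ) (τ z₁ z₂ : ℂ) (hτ : UHP τ) :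
    Hf ψ (-1 / τ) (z₁ / τ) (z₂ / τ) = τ ^ k * eC (2 * (z₁ * z₂ / τ)) * Hf ψ τ z₁ z₂ := by
  simp only [Hf]
  rw [show 2 * (z₁ * z₂ / τ) = 4 * (((((1 - I) * z₁ + (1 + I) * z₂) / 4) ^ 2 + (((1 + I) * z₁ + (1 - I) * z₂) / 4) ^ 2) / τ) by
      linear_combination (-(z₁ - z₂) ^ 2 / 2 / τ) * I_mul_I,
    ← Pf_S hf _ _ _ hτ]; congr 1 <;> ring
lemma Hf_res {k ψ} (hf : QJ k (-1) ψ) (τ z : ℂ) (hτ : UHP τ) : Hf ψ τ ((1 + I) * z) ((1 - I) * z) = ψ τ z := by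
  rw [← Pf_res hf _ _ hτ]
  simp only [Hf]; congr 1
  · linear_combination (-z / 2) * I_mul_I
  · linear_combination (z / 2) * I_mul_I

section
variable {H : ℂ → ℂ → ℂ → ℂ}

lemma ell_one {τ : ℂ} (h1 : ∀ z₁ z₂, H τ (z₁ + 1) (z₂ + 1) = H τ z₁ z₂) (n : ℤ) :
    ∀ z₁ z₂, H τ (z₁ + n) (z₂ + n) = H τ z₁ z₂ := by
  induction n using Int.induction_on with
  | zero => simp
  | succ n ih => intro z₁ z₂; rw [← ih z₁, ← h1 (z₁ + ((n : ℤ) : ℂ))]; congr 1 <;> push_cast <;> ring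
  | pred n ih => intro z₁ z₂; rw [← ih z₁, ← h1]; congr 1 <;> push_cast <;> ring

lemma ell_tau {τ : ℂ} (h1 : ∀ z₁ z₂, H τ (z₁ + τ) (z₂ + τ) = eC (-2 * (τ + z₁ + z₂)) * H τ z₁ z₂) (n : ℤ) :
    ∀ z₁ z₂, H τ (z₁ + n * τ) (z₂ + n * τ) = eC (-2 * ((n:ℂ) ^ 2 * τ + n * z₁ + n * z₂)) * H τ z₁ z₂ := by
  induction n using Int.induction_on with
  | zero => simp [eC_zero]
  | succ n ih =>
    intro z₁ z₂
    have := h1 (z₁ + (n : ℤ) * τ) (z₂ + (n : ℤ) * τ)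
    rw [ih, ← mul_assoc, ← eC_add] at this
    convert this using 2 <;> push_cast <;> ring_nf
  | pred n ih =>
    intro z₁ z₂
    have := h1 (z₁ + ((-n - 1 : ℤ) : ℂ) * τ) (z₂ + ((-n - 1 : ℤ) : ℂ) * τ)
    rw [show z₁ + ((-n - 1 : ℤ) : ℂ) * τ + τ = z₁ + ((-n : ℤ) : ℂ) * τ by push_cast; ring,
      show z₂ + ((-n - 1 : ℤ) : ℂ) * τ + τ = z₂ + ((-n : ℤ) : ℂ) * τ by push_cast; ring, ih] at this
    refine mul_left_cancel₀ (eC_ne_zero _) (this.symm.trans ?_)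
    rw [← mul_assoc, ← eC_add]; congr 2; push_cast; ring

lemma ell_all {τ : ℂ} (h1 : ∀ z₁ z₂, H τ (z₁ + 1) (z₂ + 1) = H τ z₁ z₂)
    (h2 : ∀ z₁ z₂, H τ (z₁ + τ) (z₂ + τ) = eC (-2 * (τ + z₁ + z₂)) * H τ z₁ z₂)
    (h3 : ∀ z₁ z₂, H τ (I * z₁) (-I * z₂) = I * H τ z₁ z₂) (p q u v : ℤ) (z₁ z₂ : ℂ) :
    H τ (z₁ + (p + q * I) * τ + (u + v * I)) (z₂ + (p - q * I) * τ + (u - v * I))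
      = eC (-2 * (((p:ℂ) ^ 2 + (q:ℂ) ^ 2) * τ + (p - q * I) * z₁ + (p + q * I) * z₂)) * H τ z₁ z₂ := by
  have h3' : ∀ z₁ z₂, H τ z₁ z₂ = I * H τ (-I * z₁) (I * z₂) := by
    intro z₁ z₂
    rw [← h3]; congr 1
    · linear_combination z₁ * I_mul_I
    · linear_combination z₂ * I_mul_I
  have e1 : ∀ z₁ z₂, H τ (z₁ + v * I) (z₂ - v * I) = H τ z₁ z₂ := by
    intro z₁ z₂
    rw [h3' (z₁ + v * I), h3' z₁, ← ell_one h1 v (-I * z₁)]; congr 2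
    · linear_combination (-(v:ℂ)) * I_mul_I
    · linear_combination (-(v:ℂ)) * I_mul_I
  have e2 : ∀ z₁ z₂, H τ (z₁ + q * I * τ) (z₂ - q * I * τ) = eC (-2 * ((q:ℂ) ^ 2 * τ - q * I * z₁ + q * I * z₂)) * H τ z₁ z₂ := by
    intro z₁ z₂
    rw [h3' (z₁ + _), h3' z₁, mul_left_comm]
    congr 1
    rw [show (q:ℂ) ^ 2 * τ - q * I * z₁ + q * I * z₂ = (q:ℂ) ^ 2 * τ + q * (-I * z₁) + q * (I * z₂) by ring,
      ← ell_tau h2 q]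
    congr 1
    · linear_combination (-(q:ℂ) * τ) * I_mul_I
    · linear_combination (-(q:ℂ) * τ) * I_mul_I
  rw [show z₁ + (p + q * I) * τ + (u + v * I) = z₁ + q * I * τ + p * τ + u + v * I by ring,
    show z₂ + (p - q * I) * τ + (u - v * I) = z₂ - q * I * τ + p * τ + u - v * I by ring, e1, ell_one h1, ell_tau h2, e2,
    ← mul_assoc, ← eC_add]
  congr 2; ring

end

lemma M_facts (M : Matrix.SpecialLinearGroup (Fin 2) ℤ) (τ : ℂ) (hτ : UHP τ) :
    Mc M * τ + Md M ≠ 0 ∧ UHP ((Ma M * τ + Mb M) / (Mc M * τ + Md M)) := by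
  have h := UpperHalfPlane.coe_specialLinearGroup_apply M ⟨τ, hτ⟩
  have h' := (M • (⟨τ, hτ⟩ : UpperHalfPlane)).im_pos
  have e : (Ma M * τ + Mb M) / (Mc M * τ + Md M) = ((M • (⟨τ, hτ⟩ : UpperHalfPlane) : UpperHalfPlane) : ℂ) := by
    rw [h]; simp [Ma, Mb, Mc, Md]
  have hu : UHP ((Ma M * τ + Mb M) / (Mc M * τ + Md M)) := by rw [e]; exact h'
  refine ⟨fun h0 => ?_, hu⟩
  rw [h0] at hu; simp [UHP] at hu

lemma M_det (M : Matrix.SpecialLinearGroup (Fin 2) ℤ) : Ma M * Md M - Mb M * Mc M = 1 := by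
  have := M.2
  rw [Matrix.det_fin_two] at this
  simp only [Ma, Mb, Mc, Md]
  exact_mod_cast this
lemma Ma_mul (M N : Matrix.SpecialLinearGroup (Fin 2) ℤ) : Ma (M * N) = Ma M * Ma N + Mb M * Mc N := by
  simp [Ma, Mb, Mc, Matrix.mul_apply, Fin.sum_univ_two]
lemma Mb_mul (M N : Matrix.SpecialLinearGroup (Fin 2) ℤ) : Mb (M * N) = Ma M * Mb N + Mb M * Md N := by
  simp [Ma, Mb, Md, Matrix.mul_apply, Fin.sum_univ_two]
lemma Mc_mul (M N : Matrix.SpecialLinearGroup (Fin 2) ℤ) : Mc (M * N) = Mc M * Ma N + Md M * Mc N := by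
  simp [Ma, Mc, Md, Matrix.mul_apply, Fin.sum_univ_two]
lemma Md_mul (M N : Matrix.SpecialLinearGroup (Fin 2) ℤ) : Md (M * N) = Mc M * Mb N + Md M * Md N := by
  simp [Mb, Mc, Md, Matrix.mul_apply, Fin.sum_univ_two]

def QM (k : ℕ) (H : ℂ → ℂ → ℂ → ℂ) (M : Matrix.SpecialLinearGroup (Fin 2) ℤ) : Prop :=
  ∀ τ z₁ z₂, UHP τ → H ((Ma M * τ + Mb M) / (Mc M * τ + Md M)) (z₁ / (Mc M * τ + Md M)) (z₂ / (Mc M * τ + Md M))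
    = (Mc M * τ + Md M) ^ k * eC (2 * Mc M * z₁ * z₂ / (Mc M * τ + Md M)) * H τ z₁ z₂

lemma coc (M N : Matrix.SpecialLinearGroup (Fin 2) ℤ) (τ : ℂ) (hτ : UHP τ) :
    Mc (M * N) * τ + Md (M * N) = (Mc M * ((Ma N * τ + Mb N) / (Mc N * τ + Md N)) + Md M) * (Mc N * τ + Md N) := by
  have hN := (M_facts N τ hτ).1
  rw [Mc_mul, Md_mul]; field_simp; ring
lemma coc2 (M N : Matrix.SpecialLinearGroup (Fin 2) ℤ) (τ : ℂ) (hτ : UHP τ) :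
    Ma (M * N) * τ + Mb (M * N) = (Ma M * ((Ma N * τ + Mb N) / (Mc N * τ + Md N)) + Mb M) * (Mc N * τ + Md N) := by
  have hN := (M_facts N τ hτ).1
  rw [Ma_mul, Mb_mul]; field_simp; ring
lemma coc3 (M N : Matrix.SpecialLinearGroup (Fin 2) ℤ) (τ : ℂ) (hτ : UHP τ) :
    Mc (M * N) * (Mc N * τ + Md N) = Mc M + Mc N * (Mc (M * N) * τ + Md (M * N)) := by
  rw [Mc_mul, Md_mul]; linear_combination Mc M * M_det N

lemma QM_mul (k H) (M N : Matrix.SpecialLinearGroup (Fin 2) ℤ) (hM : QM k H M) (hN : QM k H N) : QM k H (M * N) := by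
  intro τ z₁ z₂ hτ
  obtain ⟨hj, hu⟩ := M_facts N τ hτ
  obtain ⟨hj', -⟩ := M_facts M _ hu
  have hjj := (M_facts (M * N) τ hτ).1
  have h1 := hM _ (z₁ / (Mc N * τ + Md N)) (z₂ / (Mc N * τ + Md N)) hu
  rw [hN _ _ _ hτ] at h1
  have c3 := coc3 M N τ hτ
  have c1 := coc M N τ hτ
  rw [coc2 M N τ hτ]
  set j := Mc N * τ + Md N
  set t := (Ma N * τ + Mb N) / j
  set J := Mc M * t + Md M
  rw [c1] at c3 ⊢
  rw [mul_div_mul_right _ _ hj, mul_comm J j, ← div_div, ← div_div, h1]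
  have : eC (2 * Mc (M * N) * z₁ * z₂ / (j * J)) = eC (2 * Mc M * (z₁ / j) * (z₂ / j) / J) * eC (2 * Mc N * z₁ * z₂ / j) := by
    rw [← eC_add]; congr 1; field_simp; linear_combination z₁ * z₂ * c3
  rw [this, mul_pow]; ring

lemma QM_inv (k H) (M : Matrix.SpecialLinearGroup (Fin 2) ℤ) (hM : QM k H M) : QM k H M⁻¹ := by
  intro τ z₁ z₂ hτ
  have hMN : M * M⁻¹ = 1 := mul_inv_cancel M
  generalize M⁻¹ = N at *
  obtain ⟨hj, hu⟩ := M_facts N τ hτ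
  obtain ⟨hj', -⟩ := M_facts M _ hu
  have h1 := hM _ (z₁ / (Mc N * τ + Md N)) (z₂ / (Mc N * τ + Md N)) hu
  have c3 := coc3 M N τ hτ
  have c1 := coc M N τ hτ
  have c2 := coc2 M N τ hτ
  have ea : Ma 1 = 1 := by simp [Ma]
  have eb : Mb 1 = 0 := by simp [Mb]
  have ec : Mc 1 = 0 := by simp [Mc]
  have ed : Md 1 = 1 := by simp [Md]
  rw [hMN, ea, eb] at c2
  rw [hMN, ec, ed] at c3 c1
  set j := Mc N * τ + Md N
  set t := (Ma N * τ + Mb N) / j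
  set J := Mc M * t + Md M
  have hJ : J * j = 1 := by linear_combination -c1
  have hτ' : (Ma M * t + Mb M) / J = τ := by
    rw [div_eq_iff hj']; apply mul_right_cancel₀ hj; linear_combination -c2 - τ * hJ
  have hz : ∀ z, z / j / J = z := by intro z; rw [div_div, mul_comm j, hJ, div_one]
  rw [hτ', hz, hz] at h1
  rw [h1]
  have : eC (2 * Mc N * z₁ * z₂ / j) * eC (2 * Mc M * (z₁ / j) * (z₂ / j) / J) = 1 := by
    rw [← eC_add, ← eC_zero]; congr 1
    rw [show Mc M = - Mc N by linear_combination -c3]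
    rw [show 2 * -Mc N * (z₁ / j) * (z₂ / j) / J = 2 * -Mc N * z₁ * z₂ / j / (J * j) by field_simp, hJ]; ring
  have h2 : j ^ k * J ^ k = 1 := by rw [← mul_pow, mul_comm, hJ, one_pow]
  linear_combination (-H t (z₁ / j) (z₂ / j)) * (this * (j ^ k * J ^ k) + h2)

lemma QM_all (k H) (hT : ∀ τ z₁ z₂, UHP τ → H (τ + 1) z₁ z₂ = H τ z₁ z₂)
    (hS : ∀ τ z₁ z₂, UHP τ → H (-1 / τ) (z₁ / τ) (z₂ / τ) = τ ^ k * eC (2 * (z₁ * z₂ / τ)) * H τ z₁ z₂)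
    (M : Matrix.SpecialLinearGroup (Fin 2) ℤ) : QM k H M := by
  have hM : M ∈ Subgroup.closure {ModularGroup.S, ModularGroup.T} := by
    rw [SpecialLinearGroup.SL2Z_generators]; trivial
  induction hM using Subgroup.closure_induction with
  | mem x hx =>
    rcases hx with rfl | rfl
    · intro τ z₁ z₂ hτ
      simpa [Ma, Mb, Mc, Md, eC_zero, ModularGroup.S, mul_div_assoc, mul_assoc] using hS τ z₁ z₂ hτ
    · intro τ z₁ z₂ hτ
      simpa [Ma, Mb, Mc, Md, eC_zero, ModularGroup.T] using hT τ z₁ z₂ hτ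
  | one => intro τ z₁ z₂ hτ; simp [Ma, Mb, Mc, Md, eC_zero]
  | mul x y _ _ hx hy => exact QM_mul k H x y hx hy
  | inv x _ hx => exact QM_inv k H x hx

lemma isOpen_UHP : IsOpen {p : ℂ × ℂ | UHP p.1} := by
  have : {p : ℂ × ℂ | UHP p.1} = (fun p : ℂ × ℂ => p.1.im) ⁻¹' Set.Ioi 0 := rfl
  rw [this]
  exact isOpen_Ioi.preimage (by fun_prop)

lemma diff_comp {f : ℂ → ℂ → ℂ} (hf : ∀ τ z, UHP τ → DifferentiableAt ℂ (fun p : ℂ × ℂ => f p.1 p.2) (τ, z))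
    (l : ℂ × ℂ × ℂ → ℂ) (hl : Differentiable ℂ l) (p : ℂ × ℂ × ℂ) (hp : UHP p.1) :
    DifferentiableAt ℂ (fun p : ℂ × ℂ × ℂ => f p.1 (l p)) p :=
  (hf p.1 (l p) hp).comp p (f := fun p : ℂ × ℂ × ℂ => (p.1, l p)) (by fun_prop)

lemma Af_diff {f g : ℂ → ℂ → ℂ} (hf : ∀ τ z, UHP τ → DifferentiableAt ℂ (fun p : ℂ × ℂ => f p.1 p.2) (τ, z))
    (hg : ∀ τ z, UHP τ → DifferentiableAt ℂ (fun p : ℂ × ℂ => g p.1 p.2) (τ, z))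
    (l m : ℂ × ℂ × ℂ → ℂ) (hl : Differentiable ℂ l) (hm : Differentiable ℂ m) (p : ℂ × ℂ × ℂ) (hp : UHP p.1) :
    DifferentiableAt ℂ (fun p : ℂ × ℂ × ℂ => Af f g p.1 (l p) (m p)) p := by
  simp only [Af]
  have A := fun l hl => diff_comp hf l hl p hp
  have B := fun l hl => diff_comp hg l hl p hp
  have hE : DifferentiableAt ℂ (fun p : ℂ × ℂ × ℂ => eC (2 * p.1 + 4 * l p + 4 * m p)) p :=
    (eC_differentiable _).comp p (by fun_prop)
  exact (((A _ hl).mul (B _ hm)).add ((A _ (by fun_prop)).mul (B _ (by fun_prop)))).add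
    (hE.mul (((A _ (by fun_prop)).mul (B _ (by fun_prop))).add ((A _ (by fun_prop)).mul (B _ (by fun_prop)))))

lemma Hf_holo {k ψ} (h : IsJF k 4 ψ) :
    DifferentiableOn ℂ (fun p : ℂ × ℂ × ℂ => Hf ψ p.1 p.2.1 p.2.2) {p | UHP p.1} := by
  intro p hp
  have hψ : ∀ τ z, UHP τ → DifferentiableAt ℂ (fun p : ℂ × ℂ => ψ p.1 p.2) (τ, z) :=
    fun τ z hτ => h.holo.differentiableAt (isOpen_UHP.mem_nhds hτ)
  have A := fun l m hl hm => Af_diff hψ Kf_dAt l m hl hm p hp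
  simp only [Hf, Pf]
  exact ((A _ _ (by fun_prop) (by fun_prop)).sub ((A _ _ (by fun_prop) (by fun_prop)).const_mul I)).differentiableWithinAt

lemma Hf_transf {k ψ} (hk4 : k % 4 = 1) (hf : QJ k (-1) ψ) (ε : ℂ) (hε : ε ∈ ({1, -1, I, -I} : Set ℂ))
    (τ z₁ z₂ : ℂ) (hτ : UHP τ) : Hf ψ τ (ε * z₁) ((starRingEnd ℂ) ε * z₂) = ε ^ k * Hf ψ τ z₁ z₂ := by
  have hk : ε ^ k = ε := by
    have h4 : ε ^ 4 = 1 := by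
      rcases hε with rfl | rfl | rfl | rfl
      · simp
      · norm_num
      · exact I_pow_four
      · rw [neg_pow, I_pow_four]; norm_num
    rw [← Nat.div_add_mod k 4, hk4, pow_add, pow_mul, h4]; simp
  rw [hk]
  have r := fun z₁ z₂ => Hf_rot hf τ z₁ z₂ hτ
  have r2 : ∀ z₁ z₂, Hf ψ τ (-z₁) (-z₂) = - Hf ψ τ z₁ z₂ := by
    intro z₁ z₂
    rw [show -z₁ = I * (I * z₁) by linear_combination (-z₁) * I_mul_I,
      show -z₂ = -I * (-I * z₂) by linear_combination (-z₂) * I_mul_I, r, r]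
    linear_combination (Hf ψ τ z₁ z₂) * I_mul_I
  rcases hε with rfl | rfl | rfl | rfl
  · simp
  · simp [r2]
  · simpa using r z₁ z₂
  · have := r2 (I * z₁) (-I * z₂)
    rw [r] at this
    simpa using this

lemma Pf_exp {k ψ} (hk4 : k % 4 = 1) (h : IsJF k 4 ψ) :
    HasExp (fun N r s => (-1 ≤ 2 * N - r ^ 2 - s ^ 2 ∧ 8 ∣ N) ∧ 2 ∣ r + s) (Pf ψ) := by
  have hq := QJ_psi k hk4 ψ h
  refine HasExp.avgH (HasExp.avgT ?_ (fun τ u v hτ => Pf_T hq τ u v hτ)) (fun τ u v hτ => Pf_half hq τ u v hτ)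
  have h0 : HasExp (fun N r s => -1 ≤ 2 * N - r ^ 2 - s ^ 2) (fun τ u v => ψ τ u * Kf τ v) := by
    refine (psi_exp k hk4 ψ h).mul K_exp ?_
    rintro a b c a' b' c' ⟨rfl, h1⟩ ⟨rfl, h2⟩
    simp only [zero_add, add_zero]; linarith
  have h1 := h0.shift 0 0 0 1 0 0 (S' := fun N r s => -1 ≤ 2 * N - r ^ 2 - s ^ 2) (fun x y z hx => by simpa using hx)
  have h2 := h0.shift 16 4 4 0 1 0 (S' := fun N r s => -1 ≤ 2 * N - r ^ 2 - s ^ 2) (fun x y z hx => by linarith)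
  have h3 := h0.shift 16 4 4 1 1 0 (S' := fun N r s => -1 ≤ 2 * N - r ^ 2 - s ^ 2) (fun x y z hx => by linarith)
  have hA : HasExp (fun N r s => -1 ≤ 2 * N - r ^ 2 - s ^ 2) (Af ψ Kf) := by
    refine (((h0.add h1).add h2).add h3).congr (fun τ u v hτ => ?_)
    simp only [Af]
    push_cast
    rw [show (0:ℂ) * τ / 8 + 0 * u + 0 * v = 0 by ring, eC_zero, add_zero,
      show (16:ℂ) * τ / 8 + 4 * u + 4 * v = 2 * τ + 4 * u + 4 * v by ring,
      show (1:ℂ) / 2 + 0 * τ / 2 = 1 / 2 by ring, show (0:ℂ) / 2 + 1 * τ / 2 = τ / 2 by ring,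
      show (1:ℂ) / 2 + 1 * τ / 2 = (τ + 1) / 2 by ring]
    ring
  have hB := (hA.swap.mono (S' := fun N r s => -1 ≤ 2 * N - r ^ 2 - s ^ 2) (fun a b c h => by linarith)).const_mul (-I)
  exact (hA.add hB).congr (fun τ u v hτ => by simp only [Pf]; ring)

lemma Hf_fourier {k ψ} (hk4 : k % 4 = 1) (h : IsJF k 4 ψ) : ∃ c : ℕ → ℤ → ℤ → ℂ,
      (∀ (n : ℕ) (a b : ℤ), 4 * (n : ℤ) * (2 : ℕ) < a ^ 2 + b ^ 2 → c n a b = 0) ∧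
      ∀ τ z₁ z₂ : ℂ, UHP τ →
        HasSum (fun p : ℕ × ℤ × ℤ => c p.1 p.2.1 p.2.2 *
          eC ((p.1 : ℂ) * τ + (((p.2.1 : ℂ) + (p.2.2 : ℂ) * Complex.I) / 2) * z₁
            + (((p.2.1 : ℂ) - (p.2.2 : ℂ) * Complex.I) / 2) * z₂)) (Hf ψ τ z₁ z₂) := by
  obtain ⟨ι, c, N, r, s, hS, hc⟩ := Pf_exp hk4 h
  have key : ∀ i, ∃ (n : ℕ) (a b : ℤ), N i = 8 * n ∧ r i = a - b ∧ s i = a + b ∧ a ^ 2 + b ^ 2 ≤ 8 * n := by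
    intro i
    obtain ⟨⟨h1, ⟨m, h2⟩⟩, ⟨a, h3⟩⟩ := hS i
    have hr : r i = a - (s i - a) := by linarith
    have hs : s i = a + (s i - a) := by ring
    obtain ⟨b, hb⟩ : ∃ b, b = s i - a := ⟨_, rfl⟩
    rw [← hb] at hr hs
    rw [h2, hr, hs] at h1
    have h4 : -1 ≤ 2 * (8 * m - (a ^ 2 + b ^ 2)) := by linarith
    have h5 : a ^ 2 + b ^ 2 ≤ 8 * m := by omega
    have h6 : 0 ≤ m := by nlinarith [sq_nonneg a, sq_nonneg b]
    lift m to ℕ using h6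
    exact ⟨m, a, b, h2, hr, hs, h5⟩
  choose n a b hN hr hs hle using key
  obtain ⟨d, hd0, hd⟩ := hasSum_push' (ι := ι) (κ := ℕ × ℤ × ℤ) (P := ℂ × ℂ × ℂ)
    (fun i => (n i, a i, b i)) c
    (fun p x => eC ((p.1 : ℂ) * x.1 + (((p.2.1 : ℂ) + (p.2.2 : ℂ) * Complex.I) / 2) * x.2.1
            + (((p.2.1 : ℂ) - (p.2.2 : ℂ) * Complex.I) / 2) * x.2.2)) {p | UHP p.1}
    (fun x => Hf ψ x.1 x.2.1 x.2.2) {p | p.2.1 ^ 2 + p.2.2 ^ 2 ≤ 8 * p.1}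
    (fun i hi => absurd (hle i) hi) (fun x hx => by
      refine hasSum_cg (hc x.1 _ _ hx) (fun i => ?_) rfl
      simp only []
      rw [hN, hr, hs]
      congr 2
      push_cast
      ring)
  refine ⟨fun n a b => d (n, a, b), fun n a b hr => hd0 _ ?_, fun τ z₁ z₂ hτ => hd (τ, z₁, z₂) hτ⟩
  simp only [Set.mem_ofPred_eq, not_le]
  push_cast at hr; linarith

lemma part3 (k : ℕ) (hk4 : k % 4 = 1) (ψ : ℂ → ℂ → ℂ) (h : IsJF k 4 ψ) :
      ∃ φ : ℂ → ℂ → ℂ → ℂ, IsHJF k 2 φ ∧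
        ∀ τ z : ℂ, UHP τ → φ τ ((1 + Complex.I) * z) ((1 - Complex.I) * z) = ψ τ z := by
  have hq := QJ_psi k hk4 ψ h
  refine ⟨Hf ψ, ⟨Hf_holo h, ?_, ?_, Hf_fourier hk4 h⟩, fun τ z hτ => Hf_res hq τ z hτ⟩
  · intro ε hε M τ z₁ z₂ hτ
    have h1 := QM_all k (Hf ψ) (fun τ z₁ z₂ hτ => Hf_T hq τ z₁ z₂ hτ) (fun τ z₁ z₂ hτ => Hf_S hq τ z₁ z₂ hτ) M τ
      (ε * z₁) ((starRingEnd ℂ) ε * z₂) hτ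
    rw [h1, Hf_transf hk4 hq ε hε _ _ _ hτ]
    have he : ε * (starRingEnd ℂ) ε = 1 := by
      rcases hε with rfl | rfl | rfl | rfl <;> simp
    rw [show 2 * Mc M * (ε * z₁) * ((starRingEnd ℂ) ε * z₂) = 2 * Mc M * z₁ * z₂ by linear_combination 2 * Mc M * z₁ * z₂ * he]
    push_cast; ring
  · intro p q u v τ z₁ z₂ hτ
    exact_mod_cast ell_all (fun z₁ z₂ => Hf_one hq τ z₁ z₂ hτ) (fun z₁ z₂ => Hf_tau hq τ z₁ z₂ hτ)
      (fun z₁ z₂ => Hf_rot hq τ z₁ z₂ hτ) p q u v z₁ z₂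

/-- for `k ≡ 1 (mod 4)`, the restriction map
`π_{1+i} : J_{k,2}(O_K) → J_{k,4}` is an isomorphism of ℂ-vector spaces. -/
theorem stmt14 (k : ℕ) (hk : 0 < k) (hk4 : k % 4 = 1) :
    (∀ φ : ℂ → ℂ → ℂ → ℂ, IsHJF k 2 φ →
      IsJF k 4 (fun τ z => φ τ ((1 + Complex.I) * z) ((1 - Complex.I) * z))) ∧
    (∀ φ φ' : ℂ → ℂ → ℂ → ℂ, IsHJF k 2 φ → IsHJF k 2 φ' →
      (∀ τ z : ℂ, UHP τ →
        φ τ ((1 + Complex.I) * z) ((1 - Complex.I) * z)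
          = φ' τ ((1 + Complex.I) * z) ((1 - Complex.I) * z)) →
      ∀ τ z₁ z₂ : ℂ, UHP τ → φ τ z₁ z₂ = φ' τ z₁ z₂) ∧
    (∀ ψ : ℂ → ℂ → ℂ, IsJF k 4 ψ →
      ∃ φ : ℂ → ℂ → ℂ → ℂ, IsHJF k 2 φ ∧
        ∀ τ z : ℂ, UHP τ → φ τ ((1 + Complex.I) * z) ((1 - Complex.I) * z) = ψ τ z) := by
  exact ⟨part1 k, part2 k hk4, part3 k hk4⟩
end
end

section
/- Let φ ∈ J_{k,1}(O_K) with theta decomposition φ = h_0 θ^H_{1,0} + h_{1/2} θ^H_{1,1/2} + h_{i/2} θ^H_{1,i/2} + h_{(1+i)/2} θ^H_{1,(1+i)/2}. Then (U_{1+i}φ)(τ,z₁,z₂) := φ(τ,(1+i)z₁,(1-i)z₂) has theta decomposition U_{1+i}φ = h_0 (θ^H_{2,0} + θ^H_{2,1+i}) + h_{1/2} (θ^H_{2,(1+i)/2} + θ^H_{2,(3+3i)/2}) + h_{i/2} (θ^H_{2,(3+i)/2} + θ^H_{2,(1+3i)/2}) + h_{(1+i)/2} (θ^H_{2,i} + θ^H_{2,1}).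 In particular, θ^H_{1,0}(τ,(1+i)z₁,(1-i)z₂) = θ^H_{2,0} + θ^H_{2,1+i}, θ^H_{1,1/2}(τ,(1+i)z₁,(1-i)z₂) = θ^H_{2,(1+i)/2} + θ^H_{2,(3+3i)/2}, θ^H_{1,i/2}(τ,(1+i)z₁,(1-i)z₂) = θ^H_{2,(3+i)/2} + θ^H_{2,(1+3i)/2}, and θ^H_{1,(1+i)/2}(τ,(1+i)z₁,(1-i)z₂) = θ^H_{2,i} + θ^H_{2,1}. -/
noncomputable section

open Complex

lemma split_tsum (f : ℤ × ℤ → ℂ) (hf : Summable f) (p q p' q' : ℤ)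
    (hpar : (p - q) % 2 ≠ (p' - q') % 2) :
    ∑' g, f g = ∑' g : ℤ × ℤ, f (g.1 + g.2 + p, g.2 - g.1 + q)
      + ∑' g : ℤ × ℤ, f (g.1 + g.2 + p', g.2 - g.1 + q') := by
  have inj : ∀ p q : ℤ, Function.Injective
      (fun g : ℤ × ℤ => ((g.1 + g.2 + p, g.2 - g.1 + q) : ℤ × ℤ)) := by
    rintro p q ⟨a, b⟩ ⟨c, d⟩ h
    simp only [Prod.mk.injEq] at h ⊢
    omega
  have hc : IsCompl (Set.range (fun g : ℤ × ℤ => ((g.1 + g.2 + p, g.2 - g.1 + q) : ℤ × ℤ)))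
      (Set.range (fun g : ℤ × ℤ => ((g.1 + g.2 + p', g.2 - g.1 + q') : ℤ × ℤ))) := by
    constructor
    · rw [Set.disjoint_left]
      rintro _ ⟨⟨a, b⟩, rfl⟩ ⟨⟨c, d⟩, h⟩
      simp only [Prod.mk.injEq] at h
      omega
    · rw [codisjoint_iff_le_sup]
      rintro ⟨x, y⟩ -
      by_cases hx : (x - y) % 2 = (p - q) % 2
      · left
        refine ⟨((x - y - (p - q)) / 2, (x + y - (p + q)) / 2), ?_⟩
        simp only [Prod.mk.injEq]
        omega
      · right
        refine ⟨((x - y - (p' - q')) / 2, (x + y - (p' + q')) / 2), ?_⟩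
        simp only [Prod.mk.injEq]
        omega
  have h1 := (hf.comp_injective (inj p q)).hasSum
  have h2 := (hf.comp_injective (inj p' q')).hasSum
  exact (((inj p q).hasSum_range_iff.2 h1).add_isCompl hc ((inj p' q').hasSum_range_iff.2 h2)).tsum_eq

lemma summable_one (a b : ℤ) (τ z₁ z₂ : ℂ) (hτ : UHP τ) :
    Summable (fun g : ℤ × ℤ =>
    eC ((((a : ℂ) + 2 * (1 : ℕ) * g.1) ^ 2 + ((b : ℂ) + 2 * (1 : ℕ) * g.2) ^ 2) / (4 * (1 : ℕ)) * τ
      + (((a : ℂ) + 2 * (1 : ℕ) * g.1) + ((b : ℂ) + 2 * (1 : ℕ) * g.2) * Complex.I) / 2 * z₁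
      + (((a : ℂ) + 2 * (1 : ℕ) * g.1) - ((b : ℂ) + 2 * (1 : ℕ) * g.2) * Complex.I) / 2 * z₂)) := by
  have hp : 0 < (2 * τ).im := by
    have : 0 < τ.im := hτ
    simpa using this
  have h1 := ((summable_jacobiTheta₂_term_iff (a * τ + z₁ + z₂) (2 * τ)).2 hp)
  have h2 := ((summable_jacobiTheta₂_term_iff (b * τ + Complex.I * (z₁ - z₂)) (2 * τ)).2 hp)
  have h3 := (summable_mul_of_summable_norm h1.norm h2.norm).mul_left
    (eC ((a ^ 2 + b ^ 2) / 4 * τ + (a + b * Complex.I) / 2 * z₁ + (a - b * Complex.I) / 2 * z₂))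
  refine h3.congr fun g => ?_
  simp only [eC, jacobiTheta₂_term]
  rw [← Complex.exp_add, ← Complex.exp_add]
  congr 1
  push_cast
  ring

lemma key (a b a' b' a'' b'' p q p' q' : ℤ) (hpar : (p - q) % 2 ≠ (p' - q') % 2)
    (e1 : a' = a - b + 2 * (p - q)) (e2 : b' = a + b + 2 * (p + q))
    (e3 : a'' = a - b + 2 * (p' - q')) (e4 : b'' = a + b + 2 * (p' + q'))
    (τ z₁ z₂ : ℂ) (hτ : UHP τ) :
    thetaH 1 a b τ ((1 + Complex.I) * z₁) ((1 - Complex.I) * z₂)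
      = thetaH 2 a' b' τ z₁ z₂ + thetaH 2 a'' b'' τ z₁ z₂ := by
  subst e1 e2 e3 e4
  unfold thetaH
  rw [split_tsum _ (summable_one a b τ _ _ hτ) p q p' q' hpar]
  congr 1 <;>
  · refine tsum_congr fun g => ?_
    congr 1
    push_cast
    ring_nf
    simp only [Complex.I_sq]
    ring

/-- theta decomposition of `U_{1+i}φ` for `φ ∈ J_{k,1}(O_K)`, together with
the four underlying theta identities. Here `h a b` is the theta component of `φ` at
`s = (a + b i)/2`. -/
theorem stmt15 (k : ℕ) (hk : 0 < k) (φ : ℂ → ℂ → ℂ → ℂ) (h : ℤ → ℤ → ℂ → ℂ)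
    (hφ : IsHJF k 1 φ) (hdec : HasThetaDecomp 1 φ h) :
    (∀ τ z₁ z₂ : ℂ, UHP τ →
      thetaH 1 0 0 τ ((1 + Complex.I) * z₁) ((1 - Complex.I) * z₂)
        = thetaH 2 0 0 τ z₁ z₂ + thetaH 2 2 2 τ z₁ z₂) ∧
    (∀ τ z₁ z₂ : ℂ, UHP τ →
      thetaH 1 1 0 τ ((1 + Complex.I) * z₁) ((1 - Complex.I) * z₂)
        = thetaH 2 1 1 τ z₁ z₂ + thetaH 2 3 3 τ z₁ z₂) ∧
    (∀ τ z₁ z₂ : ℂ, UHP τ →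
      thetaH 1 0 1 τ ((1 + Complex.I) * z₁) ((1 - Complex.I) * z₂)
        = thetaH 2 3 1 τ z₁ z₂ + thetaH 2 1 3 τ z₁ z₂) ∧
    (∀ τ z₁ z₂ : ℂ, UHP τ →
      thetaH 1 1 1 τ ((1 + Complex.I) * z₁) ((1 - Complex.I) * z₂)
        = thetaH 2 0 2 τ z₁ z₂ + thetaH 2 2 0 τ z₁ z₂) ∧
    (∀ τ z₁ z₂ : ℂ, UHP τ →
      φ τ ((1 + Complex.I) * z₁) ((1 - Complex.I) * z₂)
        = h 0 0 τ * (thetaH 2 0 0 τ z₁ z₂ + thetaH 2 2 2 τ z₁ z₂)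
          + h 1 0 τ * (thetaH 2 1 1 τ z₁ z₂ + thetaH 2 3 3 τ z₁ z₂)
          + h 0 1 τ * (thetaH 2 3 1 τ z₁ z₂ + thetaH 2 1 3 τ z₁ z₂)
          + h 1 1 τ * (thetaH 2 0 2 τ z₁ z₂ + thetaH 2 2 0 τ z₁ z₂)) := by
  have k1 := key 0 0 0 0 2 2 0 0 1 0 (by decide) (by norm_num) (by norm_num) (by norm_num) (by norm_num)
  have k2 := key 1 0 1 1 3 3 0 0 1 0 (by decide) (by norm_num) (by norm_num) (by norm_num) (by norm_num)
  have k3 := key 0 1 3 1 1 3 1 (-1) 1 0 (by decide) (by norm_num) (by norm_num) (by norm_num) (by norm_num)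
  have k4 := key 1 1 0 2 2 0 0 0 0 (-1) (by decide) (by norm_num) (by norm_num) (by norm_num) (by norm_num)
  refine ⟨k1, k2, k3, k4, fun τ z₁ z₂ hτ => ?_⟩
  rw [hdec.2 _ _ _ hτ, ← k1 _ _ _ hτ, ← k2 _ _ _ hτ, ← k3 _ _ _ hτ, ← k4 _ _ _ hτ]
  simp only [mul_one, Finset.sum_range_succ, Finset.sum_range_zero, Nat.cast_zero, Nat.cast_one]
  ring
end
end
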